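/- (Entire solutions: asymptotics and global pointwise bound.) Let n ≥ 3 be an integer, γ < (n−2)²/4, 0 < s < 2, and write 2⋆(s) = 2(n−s)/(n−2), 2⋆ = 2n/(n−2). Suppose u ∈ C²(ℝⁿ\{0}) satisfies ∫_{ℝⁿ} |∇u|² dx < ∞, ∫_{ℝⁿ} |u|^{2⋆} dx < ∞, and −Δu(x) − γ|x|^{−2}u(x) = |u(x)|^{2⋆(s)−2}u(x)/|x|^s for all x ∈ ℝⁿ\{0}. Then there exist K₁, K₂ ∈ ℝ such that lim_{x→0} |x|^{β₋(γ)} u(x) = K₁ and lim_{|x|→∞} |x|^{β₊(γ)} u(x) = K₂; consequently there exists C > 0 such that |u(x)| ≤ C/(|x|^{β₋(γ)} + |x|^{β₊(γ)}) for all x ∈ ℝⁿ\{0}. -/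

import Mathlib

open Real Filter Set MeasureTheory

/-- The Euclidean Laplacian of `u : ℝⁿ → ℝ` at `x`, as the trace of the second derivative. -/
noncomputable def lap (n : ℕ) (u : EuclideanSpace ℝ (Fin n) → ℝ)
    (x : EuclideanSpace ℝ (Fin n)) : ℝ :=
  ∑ i : Fin n,
    fderiv ℝ (fun y => fderiv ℝ u y (EuclideanSpace.single i 1)) x (EuclideanSpace.single i 1)

/-! ### The Laplacian -/

section Laplacian

open scoped RealInnerProductSpace
open InnerProductSpace

variable {n : ℕ}

theorem fderiv_fderiv_apply_of_contDiffAt {E : Type*} [NormedAddCommGroup E] [NormedSpace ℝ E]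
    {u : E → ℝ} {x : E} (hu : ContDiffAt ℝ 2 u x) (v : E) :
    fderiv ℝ (fun y => fderiv ℝ u y v) x v = fderiv ℝ (fderiv ℝ u) x v v := by
  have h : DifferentiableAt ℝ (fderiv ℝ u) x :=
    (hu.fderiv_right (m := 1) (by norm_num)).differentiableAt (by norm_num)
  rw [fderiv_clm_apply h (differentiableAt_const v)]
  simp

theorem lap_eq_laplacian {u : EuclideanSpace ℝ (Fin n) → ℝ} {x : EuclideanSpace ℝ (Fin n)}
    (hu : ContDiffAt ℝ 2 u x) : lap n u x = Laplacian.laplacian u x := by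
  rw [laplacian_eq_iteratedFDeriv_orthonormalBasis u (EuclideanSpace.basisFun (Fin n) ℝ)]
  simp only [lap, iteratedFDeriv_two_apply]
  refine Finset.sum_congr rfl fun i _ => ?_
  rw [fderiv_fderiv_apply_of_contDiffAt hu]
  simp

theorem lap_add {u v : EuclideanSpace ℝ (Fin n) → ℝ} {x : EuclideanSpace ℝ (Fin n)}
    (hu : ContDiffAt ℝ 2 u x) (hv : ContDiffAt ℝ 2 v x) :
    lap n (fun y => u y + v y) x = lap n u x + lap n v x := by
  rw [lap_eq_laplacian (hu.add hv), lap_eq_laplacian hu, lap_eq_laplacian hv]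
  exact hu.laplacian_add hv

theorem lap_const_mul {u : EuclideanSpace ℝ (Fin n) → ℝ} {x : EuclideanSpace ℝ (Fin n)}
    (c : ℝ) (hu : ContDiffAt ℝ 2 u x) :
    lap n (fun y => c * u y) x = c * lap n u x := by
  rw [lap_eq_laplacian (contDiffAt_const.mul hu), lap_eq_laplacian hu]
  exact laplacian_smul c hu

theorem lap_sub {u v : EuclideanSpace ℝ (Fin n) → ℝ} {x : EuclideanSpace ℝ (Fin n)}
    (hu : ContDiffAt ℝ 2 u x) (hv : ContDiffAt ℝ 2 v x) :
    lap n (fun y => u y - v y) x = lap n u x - lap n v x := by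
  rw [lap_eq_laplacian (hu.sub hv), lap_eq_laplacian hu, lap_eq_laplacian hv]
  exact hu.laplacian_sub hv

theorem lap_neg {u : EuclideanSpace ℝ (Fin n) → ℝ} {x : EuclideanSpace ℝ (Fin n)}
    (hu : ContDiffAt ℝ 2 u x) :
    lap n (fun y => -u y) x = -lap n u x := by
  have := lap_const_mul (-1) hu
  simpa using this

theorem lap_comp_linearIsometryEquiv {u : EuclideanSpace ℝ (Fin n) → ℝ}
    {x : EuclideanSpace ℝ (Fin n)}
    (R : EuclideanSpace ℝ (Fin n) ≃ₗᵢ[ℝ] EuclideanSpace ℝ (Fin n))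
    (hu : ContDiffAt ℝ 2 u (R x)) :
    lap n (fun y => u (R y)) x = lap n u (R x) := by
  have hc : ContDiffAt ℝ 2 (fun y => u (R y)) x :=
    hu.comp x R.toContinuousLinearEquiv.contDiff.contDiffAt
  rw [lap_eq_laplacian hc, lap_eq_laplacian hu,
    laplacian_eq_iteratedFDeriv_orthonormalBasis _ (EuclideanSpace.basisFun (Fin n) ℝ),
    laplacian_eq_iteratedFDeriv_orthonormalBasis u
      ((EuclideanSpace.basisFun (Fin n) ℝ).map R)]
  refine Finset.sum_congr rfl fun i _ => ?_
  have h1 := R.toContinuousLinearEquiv.iteratedFDerivWithin_comp_right u uniqueDiffOn_univ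
    (x := x) (mem_univ _) 2
  simp only [preimage_univ, iteratedFDerivWithin_univ] at h1
  have h2 := congrArg (fun m => m ![EuclideanSpace.basisFun (Fin n) ℝ i,
    EuclideanSpace.basisFun (Fin n) ℝ i]) h1
  refine h2.trans ?_
  rw [ContinuousMultilinearMap.compContinuousLinearMap_apply]
  refine congrArg (iteratedFDeriv ℝ 2 u (R x)) ?_
  ext j : 1
  fin_cases j <;> simp

theorem second_deriv_nonpos_of_isLocalMax {g : ℝ → ℝ} {a : ℝ} (h : IsLocalMax g a)
    (hc : ContinuousAt g a) : deriv (deriv g) a ≤ 0 := by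
  by_contra! hpos
  have hmin := isLocalMin_of_deriv_deriv_pos hpos h.deriv_eq_zero hc
  have hconst : g =ᶠ[nhds a] fun _ => g a := by
    filter_upwards [h, hmin] with y h1 h2 using le_antisymm h1 h2
  have : deriv (deriv g) a = 0 := by
    rw [hconst.deriv.deriv_eq]
    simp
  linarith

theorem fderiv_fderiv_apply_nonpos_of_isLocalMax {E : Type*} [NormedAddCommGroup E]
    [NormedSpace ℝ E] {u : E → ℝ} {x : E} (hu : ContDiffAt ℝ 2 u x) (h : IsLocalMax u x) (v : E) :
    fderiv ℝ (fun y => fderiv ℝ u y v) x v ≤ 0 := by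
  set l : ℝ → E := fun t => x + t • v with hl
  have hl0 : l 0 = x := by simp [hl]
  have hld : ∀ t, HasDerivAt l v t := fun t => by
    simpa [hl] using! ((hasDerivAt_id t).smul_const v).const_add x
  have hlc : Tendsto l (nhds 0) (nhds x) := by
    have := (hld 0).continuousAt.tendsto
    rwa [hl0] at this
  have hg : IsLocalMax (u ∘ l) 0 := by
    have := hlc.eventually h
    simpa [IsLocalMax, IsMaxFilter, hl0] using this
  have hev : ∀ᶠ y in nhds x, DifferentiableAt ℝ u y :=
    (hu.eventually (by simp)).mono fun y hy => hy.differentiableAt (by norm_num)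
  have hd1 : deriv (u ∘ l) =ᶠ[nhds 0] fun t => fderiv ℝ u (l t) v := by
    filter_upwards [hlc.eventually hev] with t ht
    exact (ht.hasFDerivAt.comp_hasDerivAt t (hld t)).deriv
  have hd2 : DifferentiableAt ℝ (fun y => fderiv ℝ u y v) x :=
    ((hu.fderiv_right (m := 1) (by norm_num)).differentiableAt (by norm_num)).clm_apply
      (differentiableAt_const v)
  have key : deriv (deriv (u ∘ l)) 0 = fderiv ℝ (fun y => fderiv ℝ u y v) x v := by
    rw [hd1.deriv_eq]
    have h2 : HasFDerivAt (fun y => fderiv ℝ u y v) (fderiv ℝ (fun y => fderiv ℝ u y v) x) (l 0) := by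
      rw [hl0]; exact hd2.hasFDerivAt
    exact (h2.comp_hasDerivAt 0 (hld 0)).deriv
  rw [← key]
  refine second_deriv_nonpos_of_isLocalMax hg ?_
  refine ContinuousAt.comp ?_ (hld 0).continuousAt
  rw [hl0]; exact hu.continuousAt

theorem lap_nonpos_of_isLocalMax {u : EuclideanSpace ℝ (Fin n) → ℝ}
    {x : EuclideanSpace ℝ (Fin n)} (hu : ContDiffAt ℝ 2 u x) (h : IsLocalMax u x) :
    lap n u x ≤ 0 :=
  Finset.sum_nonpos fun _ _ => fderiv_fderiv_apply_nonpos_of_isLocalMax hu h _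

theorem contDiffAt_norm_rpow {E : Type*} [NormedAddCommGroup E] [InnerProductSpace ℝ E]
    (a : ℝ) {x : E} (hx : x ≠ 0) : ContDiffAt ℝ 2 (fun y : E => ‖y‖ ^ a) x :=
  (contDiffAt_norm ℝ hx).rpow_const_of_ne (norm_ne_zero_iff.2 hx)

theorem hasFDerivAt_norm_rpow_of_ne {E : Type*} [NormedAddCommGroup E] [InnerProductSpace ℝ E]
    (a : ℝ) {x : E} (hx : x ≠ 0) :
    HasFDerivAt (fun y : E => ‖y‖ ^ a) ((a * ‖x‖ ^ (a - 2)) • innerSL ℝ x) x := by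
  have hp : 0 < ‖x‖ := norm_pos_iff.2 hx
  have h1 : HasFDerivAt (fun y : E => ‖y‖ ^ 2) (2 • innerSL ℝ x) x :=
    (hasStrictFDerivAt_norm_sq x).hasFDerivAt
  have h2 := h1.rpow_const (p := a / 2) (Or.inl (by positivity))
  have h3 : (fun y : E => ‖y‖ ^ a) = fun y => (‖y‖ ^ 2) ^ (a / 2) := by
    ext y
    rw [← Real.rpow_natCast, ← Real.rpow_mul (norm_nonneg y)]
    congr 1; push_cast; ring
  rw [h3]
  convert h2 using 1
  ext v
  have : (‖x‖ ^ 2) ^ (a / 2 - 1) = ‖x‖ ^ (a - 2) := by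
    rw [← Real.rpow_natCast, ← Real.rpow_mul (norm_nonneg x)]
    congr 1; push_cast; ring
  simp only [this, smul_apply, smul_eq_mul, nsmul_eq_mul]
  push_cast; ring

/-- The model function `⟪y, e⟫ ^ k * ‖y‖ ^ a`. -/
noncomputable def innerPowMulNormRpow {E : Type*} [NormedAddCommGroup E] [InnerProductSpace ℝ E]
    (e : E) (k : ℕ) (a : ℝ) (y : E) : ℝ := ⟪y, e⟫ ^ k * ‖y‖ ^ a

theorem contDiffAt_innerPowMulNormRpow {E : Type*} [NormedAddCommGroup E] [InnerProductSpace ℝ E]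
    (e : E) (k : ℕ) (a : ℝ) {x : E} (hx : x ≠ 0) :
    ContDiffAt ℝ 2 (innerPowMulNormRpow e k a) x :=
  ((contDiffAt_id.inner ℝ contDiffAt_const).pow k).mul (contDiffAt_norm_rpow a hx)

theorem fderiv_innerPowMulNormRpow {E : Type*} [NormedAddCommGroup E] [InnerProductSpace ℝ E]
    (e : E) (k : ℕ) (a : ℝ) {x : E} (hx : x ≠ 0) (v : E) :
    fderiv ℝ (innerPowMulNormRpow e k a) x v =
      k * ⟪v, e⟫ * innerPowMulNormRpow e (k - 1) a x
        + a * (⟪x, v⟫ * innerPowMulNormRpow e k (a - 2) x) := by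
  have h1 : HasFDerivAt (fun y : E => ⟪y, e⟫) (innerSL ℝ e) x := by
    have := (innerSL ℝ e).hasFDerivAt (x := x)
    refine this.congr_of_eventuallyEq (Eventually.of_forall fun y => ?_)
    simp [real_inner_comm]
  have h2 := (h1.pow k).mul (hasFDerivAt_norm_rpow_of_ne a hx)
  have h3 : fderiv ℝ (innerPowMulNormRpow e k a) x = _ := h2.fderiv
  rw [h3]
  simp only [innerPowMulNormRpow, add_apply, smul_apply,
    smul_eq_mul, nsmul_eq_mul, innerSL_apply_apply, real_inner_comm e]
  ring

theorem lap_innerPowMulNormRpow (e : EuclideanSpace ℝ (Fin n)) (k : ℕ) (a : ℝ)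
    {x : EuclideanSpace ℝ (Fin n)} (hx : x ≠ 0) :
    lap n (innerPowMulNormRpow e k a) x =
      k * (k - 1 : ℕ) * ‖e‖ ^ 2 * (⟪x, e⟫ ^ (k - 2) * ‖x‖ ^ a)
        + a * (a + n - 2 + 2 * k) * (⟪x, e⟫ ^ k * ‖x‖ ^ (a - 2)) := by
  have hnx : ∀ᶠ y in nhds x, y ≠ 0 := isOpen_ne.mem_nhds hx
  have hd : ∀ k a, DifferentiableAt ℝ (innerPowMulNormRpow e k a) x := fun k a =>
    (contDiffAt_innerPowMulNormRpow e k a hx).differentiableAt (by norm_num)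
  have key : ∀ v : EuclideanSpace ℝ (Fin n),
      fderiv ℝ (fun y => fderiv ℝ (innerPowMulNormRpow e k a) y v) x v =
        k * (k - 1 : ℕ) * innerPowMulNormRpow e (k - 2) a x * (⟪e, v⟫ * ⟪v, e⟫)
        + 2 * a * k * innerPowMulNormRpow e (k - 1) (a - 2) x * (⟪x, v⟫ * ⟪v, e⟫)
        + a * innerPowMulNormRpow e k (a - 2) x * ‖v‖ ^ 2
        + a * (a - 2) * innerPowMulNormRpow e k (a - 2 - 2) x * (⟪x, v⟫ * ⟪v, x⟫) := by
    intro v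
    have h0 : (fun y => fderiv ℝ (innerPowMulNormRpow e k a) y v) =ᶠ[nhds x]
        fun y => k * ⟪v, e⟫ * innerPowMulNormRpow e (k - 1) a y
          + a * (⟪y, v⟫ * innerPowMulNormRpow e k (a - 2) y) := by
      filter_upwards [hnx] with y hy using fderiv_innerPowMulNormRpow e k a hy v
    rw [h0.fderiv_eq]
    have h1 : HasFDerivAt (fun y : EuclideanSpace ℝ (Fin n) => ⟪y, v⟫) (innerSL ℝ v) x := by
      have := (innerSL ℝ v).hasFDerivAt (x := x)
      refine this.congr_of_eventuallyEq (Eventually.of_forall fun y => ?_)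
      simp [real_inner_comm]
    have h2 := ((hd (k - 1) a).hasFDerivAt.const_mul (k * ⟪v, e⟫)).add
      ((h1.mul (hd k (a - 2)).hasFDerivAt).const_mul a)
    have h3 := h2.fderiv
    erw [h3]
    simp only [add_apply, smul_apply,
      smul_eq_mul, innerSL_apply_apply, fderiv_innerPowMulNormRpow e _ _ hx,
      real_inner_self_eq_norm_sq, real_inner_comm v, Nat.sub_sub]
    norm_num
    ring
  have hsum : ∀ y z : EuclideanSpace ℝ (Fin n),
      ∑ i, (⟪y, EuclideanSpace.single i (1 : ℝ)⟫ * ⟪EuclideanSpace.single i (1 : ℝ), z⟫) = ⟪y, z⟫ := by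
    intro y z
    have := (EuclideanSpace.basisFun (Fin n) ℝ).sum_inner_mul_inner y z
    simpa using this
  simp only [lap, key, Finset.sum_add_distrib, ← Finset.mul_sum, hsum]
  have hp : 0 < ‖x‖ := norm_pos_iff.2 hx
  have h4 : ‖x‖ ^ (a - 2) = ‖x‖ ^ (a - 2 - 2) * ‖x‖ ^ 2 := by
    rw [← Real.rpow_natCast, ← Real.rpow_add hp]; congr 1; push_cast; ring
  have h5 : (k : ℝ) * (⟪x, e⟫ ^ (k - 1) * ⟪x, e⟫) = k * ⟪x, e⟫ ^ k := by
    rcases k with _ | k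
    · simp
    · simp [pow_succ]
  simp only [innerPowMulNormRpow, real_inner_self_eq_norm_sq, PiLp.norm_single, norm_one, one_pow,
    Finset.sum_const, Finset.card_univ, Fintype.card_fin, nsmul_eq_mul]
  rw [h4]
  linear_combination (2 * a * ‖x‖ ^ (a - 2 - 2) * ‖x‖ ^ 2) * h5

end Laplacian

/-! ### Comparison principles -/

section Comparison

variable {n : ℕ}

/-- If `w / H` has an interior maximum above `1` on a compact set,
the inequality `w * lap H < lap w * H` fails there. -/
theorem le_of_lap_comparison {K : Set (EuclideanSpace ℝ (Fin n))} (hK : IsCompact K)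
    {w H : EuclideanSpace ℝ (Fin n) → ℝ} (hw : ContinuousOn w K) (hH : ContinuousOn H K)
    (hpos : ∀ x ∈ K, 0 < H x)
    (h : ∀ x ∈ K, H x < w x → K ∈ nhds x ∧ ContDiffAt ℝ 2 w x ∧ ContDiffAt ℝ 2 H x ∧
      w x * lap n H x < lap n w x * H x) :
    ∀ x ∈ K, w x ≤ H x := by
  intro x hx
  obtain ⟨y, hy, hmax⟩ := hK.exists_isMaxOn ⟨x, hx⟩
    (hw.div hH fun z hz => (hpos z hz).ne')
  by_contra! hlt
  have hm : 1 < w y / H y :=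
    ((one_lt_div (hpos x hx)).2 hlt).trans_le (hmax hx)
  obtain ⟨hnhds, hwc, hHc, hcmp⟩ := h y hy ((one_lt_div (hpos y hy)).1 hm)
  set m := w y / H y with hmdef
  have hmH : m * H y = w y := div_mul_cancel₀ _ (hpos y hy).ne'
  have hloc : IsLocalMax (fun z => w z - m * H z) y := by
    filter_upwards [hnhds] with z hz
    have h1 : w z / H z ≤ m := hmax hz
    rw [div_le_iff₀ (hpos z hz)] at h1
    linarith
  have hlap := lap_nonpos_of_isLocalMax (hwc.sub (contDiffAt_const.mul hHc)) hloc
  rw [lap_sub hwc (contDiffAt_const.mul hHc), lap_const_mul m hHc] at hlap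
  have h1 := mul_le_mul_of_nonneg_right hlap (hpos y hy).le
  rw [← hmH] at hcmp
  linarith

theorem continuousAt_norm_rpow {E : Type*} [NormedAddCommGroup E] (a : ℝ) {x : E} (hx : x ≠ 0) :
    ContinuousAt (fun y : E => ‖y‖ ^ a) x :=
  continuous_norm.continuousAt.rpow_const (Or.inl (norm_ne_zero_iff.2 hx))

/-- Comparison near one end (`0` for `σ = 1`, infinity for `σ = -1`) of `ℝⁿ \ {0}`, inside a
closed set `S`. The barrier `H₂` dominates `w` at the end, and `H₁` elsewhere on the boundary. -/
theorem le_of_lap_comparison_end {σ : ℝ} (hσ : σ = 1 ∨ σ = -1) {c : ℝ}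
    {S : Set (EuclideanSpace ℝ (Fin n))} (hS : IsClosed S)
    {w H₁ H₂ : EuclideanSpace ℝ (Fin n) → ℝ}
    (hw : ∀ x ≠ 0, ContDiffAt ℝ 2 w x) (hH₁ : ∀ x ≠ 0, ContDiffAt ℝ 2 H₁ x)
    (hH₂ : ∀ x ≠ 0, ContDiffAt ℝ 2 H₂ x)
    (hpos₁ : ∀ x ≠ 0, ‖x‖ ^ σ ≤ c → x ∈ S → 0 ≤ H₁ x) (hpos₂ : ∀ x ≠ 0, 0 < H₂ x)
    (hend : ∀ η > 0, ∃ ε > 0, ∀ x ≠ 0, ‖x‖ ^ σ ≤ ε → w x ≤ η * H₂ x)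
    (hout : ∀ x ≠ 0, ‖x‖ ^ σ = c → x ∈ S → w x ≤ H₁ x)
    (hside : ∀ x ≠ 0, ‖x‖ ^ σ ≤ c → x ∈ S → x ∉ interior S → w x ≤ H₁ x)
    (hlap : ∀ η > 0, ∀ x ≠ 0, ‖x‖ ^ σ ≤ c → x ∈ S → H₁ x + η * H₂ x < w x →
      w x * (lap n H₁ x + η * lap n H₂ x) < lap n w x * (H₁ x + η * H₂ x)) :
    ∀ x ≠ 0, ‖x‖ ^ σ ≤ c → x ∈ S → w x ≤ H₁ x := by
  intro x hx hxc hxS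
  have hxp : 0 < ‖x‖ := norm_pos_iff.2 hx
  have main : ∀ η > 0, w x ≤ H₁ x + η * H₂ x := by
    intro η hη
    obtain ⟨ε, hε, hεw⟩ := hend η hη
    rcases le_or_gt (‖x‖ ^ σ) ε with hxe | hxe
    · linarith [hεw x hx hxe, hpos₁ x hx hxc hxS]
    set K : Set (EuclideanSpace ℝ (Fin n)) := {y | y ≠ 0 ∧ ε ≤ ‖y‖ ^ σ ∧ ‖y‖ ^ σ ≤ c} ∩ S with hKdef
    have hc : 0 < c := (Real.rpow_pos_of_pos hxp σ).trans_le hxc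
    have hann : ∃ a b : ℝ, 0 < a ∧ {y : EuclideanSpace ℝ (Fin n) | y ≠ 0 ∧ ε ≤ ‖y‖ ^ σ ∧ ‖y‖ ^ σ ≤ c}
        = {y | a ≤ ‖y‖ ∧ ‖y‖ ≤ b} := by
      rcases hσ with rfl | rfl
      · refine ⟨ε, c, hε, ?_⟩
        ext y
        simp only [mem_ofPred_eq, Real.rpow_one]
        refine ⟨fun h => h.2, fun h => ⟨?_, h⟩⟩
        rw [← norm_pos_iff]; exact hε.trans_le h.1
      · refine ⟨c⁻¹, ε⁻¹, inv_pos.2 hc, ?_⟩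
        ext y
        simp only [mem_ofPred_eq, Real.rpow_neg_one]
        constructor
        · rintro ⟨h0, h1, h2⟩
          have h0 := norm_pos_iff.2 h0
          exact ⟨(inv_le_comm₀ h0 hc).1 h2, (le_inv_comm₀ hε h0).1 h1⟩
        · rintro ⟨h1, h2⟩
          have h0 : 0 < ‖y‖ := (inv_pos.2 hc).trans_le h1
          exact ⟨norm_pos_iff.1 h0, (le_inv_comm₀ hε h0).2 h2, (inv_le_comm₀ h0 hc).2 h1⟩
    have hK : IsCompact K := by
      obtain ⟨a, b, ha, hab⟩ := hann
      rw [hKdef, hab]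
      refine ((isCompact_closedBall (0 : EuclideanSpace ℝ (Fin n)) b).of_isClosed_subset
        ?_ fun y hy => by simpa using hy.2).inter_right hS
      exact (isClosed_le continuous_const continuous_norm).inter
        (isClosed_le continuous_norm continuous_const)
    have hHc : ∀ y ≠ 0, ContDiffAt ℝ 2 (fun y => H₁ y + η * H₂ y) y := fun y hy =>
      (hH₁ y hy).add (contDiffAt_const.mul (hH₂ y hy))
    refine le_of_lap_comparison (w := w) (H := fun y => H₁ y + η * H₂ y) hK
      (fun y hy => (hw y hy.1.1).continuousAt.continuousWithinAt)
      (fun y hy => (hHc y hy.1.1).continuousAt.continuousWithinAt) ?_ ?_ x ⟨⟨hx, hxe.le, hxc⟩, hxS⟩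
    · intro y hy
      linarith [hpos₁ y hy.1.1 hy.1.2.2 hy.2, mul_pos hη (hpos₂ y hy.1.1)]
    · rintro y ⟨⟨hy0, hyε, hyc⟩, hyS⟩ hyw
      have hp := mul_pos hη (hpos₂ y hy0)
      have hp1 := hpos₁ y hy0 hyc hyS
      refine ⟨?_, hw y hy0, hHc y hy0, ?_⟩
      · have h1 : ε < ‖y‖ ^ σ := by
          by_contra! hle
          linarith [hεw y hy0 hle]
        have h2 : ‖y‖ ^ σ < c := by
          refine lt_of_le_of_ne hyc fun heq => ?_
          linarith [hout y hy0 heq hyS]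
        have h3 : y ∈ interior S := by
          by_contra hni
          linarith [hside y hy0 hyc hyS hni]
        have hcont := continuousAt_norm_rpow σ hy0
        filter_upwards [isOpen_ne.mem_nhds hy0, hcont.eventually (lt_mem_nhds h1),
          hcont.eventually (gt_mem_nhds h2), mem_interior_iff_mem_nhds.1 h3] with z z1 z2 z3 z4
        exact ⟨⟨z1, z2.le, z3.le⟩, z4⟩
      · rw [lap_add (hH₁ y hy0) (contDiffAt_const.mul (hH₂ y hy0)), lap_const_mul η (hH₂ y hy0)]
        exact hlap η hη y hy0 hyc hyS hyw
  refine le_of_forall_pos_le_add fun ε hε => ?_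
  have h2 := hpos₂ x hx
  have := main (ε / H₂ x) (div_pos hε h2)
  rwa [div_mul_cancel₀ _ h2.ne'] at this

end Comparison

/-! ### Barriers and linear asymptotics -/

section Barriers

open scoped RealInnerProductSpace

variable {n : ℕ}

theorem lap_norm_rpow (a : ℝ) {x : EuclideanSpace ℝ (Fin n)} (hx : x ≠ 0) :
    lap n (fun y => ‖y‖ ^ a) x = a * (a + n - 2) * ‖x‖ ^ a / ‖x‖ ^ 2 := by
  have h := lap_innerPowMulNormRpow (0 : EuclideanSpace ℝ (Fin n)) 0 a hx
  have h2 : ‖x‖ ^ (a - 2) = ‖x‖ ^ a / ‖x‖ ^ 2 := by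
    rw [Real.rpow_sub (norm_pos_iff.2 hx)]; norm_cast
  have h3 : innerPowMulNormRpow (0 : EuclideanSpace ℝ (Fin n)) 0 a = fun y => ‖y‖ ^ a := by
    ext y; simp [innerPowMulNormRpow]
  rw [h3, h2] at h
  rw [h]; push_cast; ring

theorem lap_norm_rpow_of_sign {h σ : ℝ} (hn : (n : ℝ) = 2 * h + 2) (hσ : σ = 1 ∨ σ = -1) (τ : ℝ)
    {x : EuclideanSpace ℝ (Fin n)} (hx : x ≠ 0) :
    lap n (fun y => ‖y‖ ^ (-h + σ * τ)) x = (τ ^ 2 - h ^ 2) * ‖x‖ ^ (-h + σ * τ) / ‖x‖ ^ 2 := by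
  rw [lap_norm_rpow _ hx, hn]
  congr 2
  rcases hσ with rfl | rfl <;> ring

/-- `‖x‖ ^ a * (1 + 3 φ - φ ^ 2)` with `φ = ⟪x, e⟫ / ‖x‖`: a barrier on the half space
`0 ≤ ⟪x, e⟫`. -/
noncomputable def halfSpaceBarrier {E : Type*} [NormedAddCommGroup E] [InnerProductSpace ℝ E]
    (e : E) (a : ℝ) (x : E) : ℝ :=
  innerPowMulNormRpow e 0 a x + 3 * innerPowMulNormRpow e 1 (a - 1) x
    - innerPowMulNormRpow e 2 (a - 2) x

theorem contDiffAt_halfSpaceBarrier {E : Type*} [NormedAddCommGroup E] [InnerProductSpace ℝ E]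
    (e : E) (a : ℝ) {x : E} (hx : x ≠ 0) : ContDiffAt ℝ 2 (halfSpaceBarrier e a) x :=
  ((contDiffAt_innerPowMulNormRpow e 0 a hx).add
    (contDiffAt_const.mul (contDiffAt_innerPowMulNormRpow e 1 (a - 1) hx))).sub
    (contDiffAt_innerPowMulNormRpow e 2 (a - 2) hx)

theorem halfSpaceBarrier_eq {E : Type*} [NormedAddCommGroup E] [InnerProductSpace ℝ E]
    (e : E) (a : ℝ) {x : E} (hx : x ≠ 0) :
    halfSpaceBarrier e a x =
      ‖x‖ ^ a * (1 + 3 * (⟪x, e⟫ / ‖x‖) - (⟪x, e⟫ / ‖x‖) ^ 2) := by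
  have hp := norm_pos_iff.2 hx
  simp only [halfSpaceBarrier, innerPowMulNormRpow, Real.rpow_sub hp, Real.rpow_one]
  norm_cast
  field_simp

theorem inner_div_norm_mem_Icc {E : Type*} [NormedAddCommGroup E] [InnerProductSpace ℝ E]
    {e : E} (he : ‖e‖ = 1) {x : E} (hxe : 0 ≤ ⟪x, e⟫) :
    ⟪x, e⟫ / ‖x‖ ∈ Icc (0 : ℝ) 1 := by
  refine ⟨by positivity, div_le_one_of_le₀ ?_ (norm_nonneg x)⟩
  simpa [he] using real_inner_le_norm x e

theorem le_halfSpaceBarrier {E : Type*} [NormedAddCommGroup E] [InnerProductSpace ℝ E]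
    {e : E} (he : ‖e‖ = 1) (a : ℝ) {x : E} (hx : x ≠ 0) (hxe : 0 ≤ ⟪x, e⟫) :
    ‖x‖ ^ a ≤ halfSpaceBarrier e a x := by
  rw [halfSpaceBarrier_eq e a hx]
  obtain ⟨h0, h1⟩ := inner_div_norm_mem_Icc he hxe
  have h2 : 0 ≤ ‖x‖ ^ a := by positivity
  exact le_mul_of_one_le_right h2 (by nlinarith)

theorem halfSpaceBarrier_le {E : Type*} [NormedAddCommGroup E] [InnerProductSpace ℝ E]
    {e : E} (he : ‖e‖ = 1) (a : ℝ) {x : E} (hx : x ≠ 0) (hxe : 0 ≤ ⟪x, e⟫) :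
    halfSpaceBarrier e a x ≤ 3 * ‖x‖ ^ a := by
  rw [halfSpaceBarrier_eq e a hx, mul_comm 3 (‖x‖ ^ a)]
  obtain ⟨h0, h1⟩ := inner_div_norm_mem_Icc he hxe
  have h2 : 0 ≤ ‖x‖ ^ a := by positivity
  exact mul_le_mul_of_nonneg_left (by nlinarith) h2

theorem lap_halfSpaceBarrier_le (hn : 3 ≤ n) {e : EuclideanSpace ℝ (Fin n)} (he : ‖e‖ = 1)
    (a : ℝ) {x : EuclideanSpace ℝ (Fin n)} (hx : x ≠ 0) (hxe : 0 ≤ ⟪x, e⟫) :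
    lap n (halfSpaceBarrier e a) x ≤
      (a * (a + n - 2) * halfSpaceBarrier e a x - 2 * ‖x‖ ^ a) / ‖x‖ ^ 2 := by
  have hp := norm_pos_iff.2 hx
  have hc := fun k a => contDiffAt_innerPowMulNormRpow e k a hx
  have h1 : lap n (halfSpaceBarrier e a) x = lap n (innerPowMulNormRpow e 0 a) x
      + 3 * lap n (innerPowMulNormRpow e 1 (a - 1)) x - lap n (innerPowMulNormRpow e 2 (a - 2)) x := by
    have h2 := lap_sub ((hc 0 a).add ((contDiffAt_const (c := (3 : ℝ))).mul (hc 1 (a - 1))))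
      (hc 2 (a - 2))
    rw [lap_add (hc 0 a) (contDiffAt_const.mul (hc 1 (a - 1))), lap_const_mul 3 (hc 1 (a - 1))] at h2
    exact h2
  obtain ⟨h0, h2⟩ := inner_div_norm_mem_Icc he hxe
  set φ := ⟪x, e⟫ / ‖x‖ with hφ
  have hin : ⟪x, e⟫ = φ * ‖x‖ := by rw [hφ]; field_simp
  have h3 : lap n (halfSpaceBarrier e a) x = (‖x‖ ^ a / ‖x‖ ^ 2) *
      (a * (a + n - 2) * (1 + 3 * φ - φ ^ 2) - 3 * (n - 1) * φ - 2 + 2 * n * φ ^ 2) := by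
    rw [h1, lap_innerPowMulNormRpow e _ _ hx, lap_innerPowMulNormRpow e _ _ hx,
      lap_innerPowMulNormRpow e _ _ hx, hin, he]
    simp only [Real.rpow_sub hp, Real.rpow_one]
    norm_num
    field_simp
    ring
  rw [h3, halfSpaceBarrier_eq e a hx, ← hφ]
  have hn' : (3 : ℝ) ≤ n := by exact_mod_cast hn
  have h4 : (2 * n * φ ^ 2 : ℝ) ≤ 3 * (n - 1) * φ := by
    have : (0:ℝ) ≤ n * (φ * (1 - φ)) := by
      have : 0 ≤ 1 - φ := by linarith
      positivity
    nlinarith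
  have h5 : 0 ≤ ‖x‖ ^ a / ‖x‖ ^ 2 := by positivity
  calc _ ≤ (‖x‖ ^ a / ‖x‖ ^ 2) * (a * (a + n - 2) * (1 + 3 * φ - φ ^ 2) - 2) :=
        mul_le_mul_of_nonneg_left (by linarith) h5
    _ = _ := by ring

theorem exists_bound_on_sphere {u : EuclideanSpace ℝ (Fin n) → ℝ}
    (hu : ∀ x ≠ 0, ContDiffAt ℝ 2 u x) {σ : ℝ} (hσ : σ = 1 ∨ σ = -1) {c : ℝ} (hc : 0 < c) (b : ℝ) :
    ∃ A > 0, ∀ x ≠ 0, ‖x‖ ^ σ = c → |u x| ≤ A * ‖x‖ ^ b := by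
  have hR : ∀ x : EuclideanSpace ℝ (Fin n), x ≠ 0 → ‖x‖ ^ σ = c → ‖x‖ = c ^ σ := by
    intro x hx hxc
    rw [← hxc, ← Real.rpow_mul (norm_nonneg x)]
    rcases hσ with rfl | rfl <;> norm_num
  have hcont : ContinuousOn u (Metric.sphere 0 (c ^ σ)) := fun x hx =>
    (hu x (by rw [← norm_pos_iff, mem_sphere_zero_iff_norm.1 hx]; positivity)).continuousAt.continuousWithinAt
  obtain ⟨B, hB⟩ := (isCompact_sphere (0 : EuclideanSpace ℝ (Fin n)) (c ^ σ)).exists_bound_of_continuousOn hcont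
  refine ⟨(|B| + 1) / (c ^ σ) ^ b, by positivity, fun x hx hxc => ?_⟩
  rw [hR x hx hxc, div_mul_cancel₀ _ (by positivity)]
  have := hB x (by simpa using hR x hx hxc)
  rw [Real.norm_eq_abs] at this
  linarith [le_abs_self B]

theorem norm_rpow_add_sign {E : Type*} [NormedAddCommGroup E] {x : E} (hx : x ≠ 0) (a σ τ : ℝ) :
    ‖x‖ ^ (a + σ * τ) = ‖x‖ ^ a * (‖x‖ ^ σ) ^ τ := by
  rw [Real.rpow_add (norm_pos_iff.2 hx), Real.rpow_mul (norm_nonneg x)]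

/-- A solution that is `o(‖x‖ ^ (-h))` at an end, with a small perturbation of the Hardy
potential, decays like the Hardy barrier of exponent `ν < μ`. -/
theorem exists_le_of_small_potential {h μ ν σ c : ℝ} (hn : (n : ℝ) = 2 * h + 2)
    (hσ : σ = 1 ∨ σ = -1) (hc : 0 < c) (hν : 0 < ν)
    {u P : EuclideanSpace ℝ (Fin n) → ℝ}
    (hu : ∀ x ≠ 0, ContDiffAt ℝ 2 u x)
    (hlap : ∀ x ≠ 0, lap n u x = -(h ^ 2 - μ ^ 2 + P x) * u x / ‖x‖ ^ 2)
    (hP : ∀ x ≠ 0, ‖x‖ ^ σ ≤ c → P x < μ ^ 2 - ν ^ 2)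
    (hend : ∀ η > 0, ∃ ε > 0, ∀ x ≠ 0, ‖x‖ ^ σ ≤ ε → ‖x‖ ^ h * |u x| ≤ η) :
    ∃ A > 0, ∀ x ≠ 0, ‖x‖ ^ σ ≤ c → u x ≤ A * ‖x‖ ^ (-h + σ * ν) := by
  obtain ⟨A, hA, hAu⟩ := exists_bound_on_sphere hu hσ hc (-h + σ * ν)
  refine ⟨A, hA, ?_⟩
  have key := le_of_lap_comparison_end (n := n) hσ (c := c) (S := univ) isClosed_univ (w := u)
    (H₁ := fun x => A * ‖x‖ ^ (-h + σ * ν)) (H₂ := fun x => ‖x‖ ^ (-h + σ * -ν)) hu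
    (fun x hx => contDiffAt_const.mul (contDiffAt_norm_rpow _ hx))
    (fun x hx => contDiffAt_norm_rpow _ hx) (fun x _ _ _ => by positivity)
    (fun x hx => by have := norm_pos_iff.2 hx; positivity) ?_
    (fun x hx hxc _ => (le_abs_self _).trans (hAu x hx hxc)) (by simp) ?_
  · exact fun x hx hxc => key x hx hxc (mem_univ x)
  · intro η hη
    obtain ⟨ε, hε, hεu⟩ := hend η hη
    refine ⟨min ε 1, by positivity, fun x hx hxε => ?_⟩
    have hp := norm_pos_iff.2 hx
    have h1 := hεu x hx (hxε.trans (min_le_left _ _))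
    have h2 : 1 ≤ (‖x‖ ^ σ) ^ (-ν) :=
      Real.one_le_rpow_of_pos_of_le_one_of_nonpos (by positivity) (hxε.trans (min_le_right _ _))
        (by linarith)
    rw [norm_rpow_add_sign hx, Real.rpow_neg hp.le]
    have h3 : 0 < ‖x‖ ^ h := by positivity
    calc u x ≤ |u x| := le_abs_self _
      _ ≤ η * (‖x‖ ^ h)⁻¹ := by rw [← div_eq_mul_inv, le_div_iff₀ h3]; linarith
      _ ≤ η * ((‖x‖ ^ h)⁻¹ * (‖x‖ ^ σ) ^ (-ν)) := by
        gcongr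
        exact le_mul_of_one_le_right (by positivity) h2
  · intro η hη x hx hxc _ hlt
    have hp := norm_pos_iff.2 hx
    rw [lap_const_mul A (contDiffAt_norm_rpow _ hx), lap_norm_rpow_of_sign hn hσ _ hx,
      lap_norm_rpow_of_sign hn hσ _ hx, hlap x hx]
    set H := A * ‖x‖ ^ (-h + σ * ν) + η * ‖x‖ ^ (-h + σ * -ν) with hH
    have hHpos : 0 < H := by positivity
    have hPx := hP x hx hxc
    have hprod : 0 < (u x * H / ‖x‖ ^ 2) * (μ ^ 2 - ν ^ 2 - P x) :=
      mul_pos (by have := hHpos.trans hlt; positivity) (by linarith)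
    have e : -(h ^ 2 - μ ^ 2 + P x) * u x / ‖x‖ ^ 2 * H - u x *
        (A * ((ν ^ 2 - h ^ 2) * ‖x‖ ^ (-h + σ * ν) / ‖x‖ ^ 2) +
        η * (((-ν) ^ 2 - h ^ 2) * ‖x‖ ^ (-h + σ * -ν) / ‖x‖ ^ 2))
        = (u x * H / ‖x‖ ^ 2) * (μ ^ 2 - ν ^ 2 - P x) := by rw [hH]; ring
    linarith

end Barriers

section LinearAsymptotics

open scoped RealInnerProductSpace

variable {n : ℕ}

theorem mul_lt_mul_of_source_lt {γ r f g w H Lw LH : ℝ} (hLw : Lw = -γ * w / r - f)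
    (hLH : LH ≤ -γ * H / r - g) (hfg : |f| < g) (hH : 0 < H) (hw : H < w) :
    w * LH < Lw * H := by
  have h1 : w * LH ≤ w * (-γ * H / r - g) := mul_le_mul_of_nonneg_left hLH (hH.trans hw).le
  have h2 : f * H < g * w := by
    have h3 : f * H ≤ |f| * H := mul_le_mul_of_nonneg_right (le_abs_self f) hH.le
    have h4 : |f| * H < g * H := mul_lt_mul_of_pos_right hfg hH
    have h5 : g * H < g * w := mul_lt_mul_of_pos_left hw ((abs_nonneg f).trans_lt hfg)
    linarith
  have e : Lw * H - w * (-γ * H / r - g) = g * w - f * H := by rw [hLw]; ring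
  linarith

theorem norm_rpow_le_of_end {h μ σ : ℝ} (hμ : 0 < μ) {η : ℝ} (hη : 0 < η) :
    ∃ ε > 0, ∀ x : EuclideanSpace ℝ (Fin n), x ≠ 0 → ‖x‖ ^ σ ≤ ε →
      ‖x‖ ^ (-h + σ * μ) ≤ η * ‖x‖ ^ (-h + σ * -μ) := by
  refine ⟨η ^ (1 / (2 * μ)), by positivity, fun x hx hxε => ?_⟩
  have hp := norm_pos_iff.2 hx
  have h1 : (‖x‖ ^ σ) ^ (2 * μ) ≤ η := by
    have := Real.rpow_le_rpow (by positivity) hxε (by positivity : 0 ≤ 2 * μ)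
    rwa [← Real.rpow_mul hη.le, one_div_mul_cancel (by positivity), Real.rpow_one] at this
  have h2 : ‖x‖ ^ (-h + σ * μ) = (‖x‖ ^ σ) ^ (2 * μ) * ‖x‖ ^ (-h + σ * -μ) := by
    rw [← Real.rpow_mul hp.le, ← Real.rpow_add hp]; congr 1; ring
  rw [h2]
  gcongr

/-- Upper bounds on a sphere propagate towards the end, up to a small error. -/
theorem exists_sphere_bound_propagates {h μ τ σ c C : ℝ} (hn : (n : ℝ) = 2 * h + 2)
    (hσ : σ = 1 ∨ σ = -1) (hμ : 0 < μ) (hτ : μ < τ) (hC : 0 ≤ C)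
    {w f : EuclideanSpace ℝ (Fin n) → ℝ}
    (hw : ∀ x ≠ 0, ContDiffAt ℝ 2 w x)
    (hlap : ∀ x ≠ 0, lap n w x = -(h ^ 2 - μ ^ 2) * w x / ‖x‖ ^ 2 - f x)
    (hf : ∀ x ≠ 0, ‖x‖ ^ σ ≤ c → |f x| ≤ C * ‖x‖ ^ (-h + σ * τ) / ‖x‖ ^ 2)
    (hend : ∀ η > 0, ∃ ε > 0, ∀ x ≠ 0, ‖x‖ ^ σ ≤ ε → |w x| ≤ η * ‖x‖ ^ (-h + σ * -μ)) :
    ∃ A > 0, ∀ ρ > 0, ρ ≤ c → ∀ B : ℝ,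
      (∀ x ≠ 0, ‖x‖ ^ σ = ρ → w x ≤ B * ‖x‖ ^ (-h + σ * μ)) →
      ∀ x ≠ 0, ‖x‖ ^ σ ≤ ρ → w x ≤ (B + A * ρ ^ (τ - μ)) * ‖x‖ ^ (-h + σ * μ) := by
  have hd : 0 < τ ^ 2 - μ ^ 2 := by nlinarith
  set A := C / (τ ^ 2 - μ ^ 2) + 1 with hAdef
  have hA : 0 < A := by positivity
  have hAC : C < A * (τ ^ 2 - μ ^ 2) := by
    rw [hAdef, add_mul, div_mul_cancel₀ _ hd.ne']; linarith
  refine ⟨A, hA, fun ρ hρ hρc B hB => ?_⟩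
  have hN : ∀ a : ℝ, ∀ x : EuclideanSpace ℝ (Fin n), x ≠ 0 →
    ContDiffAt ℝ 2 (fun y : EuclideanSpace ℝ (Fin n) => ‖y‖ ^ a) x :=
    fun a x hx => contDiffAt_norm_rpow a hx
  have hsplit : ∀ x : EuclideanSpace ℝ (Fin n), x ≠ 0 →
      ‖x‖ ^ (-h + σ * τ) = (‖x‖ ^ σ) ^ (τ - μ) * ‖x‖ ^ (-h + σ * μ) := by
    intro x hx
    have hp := norm_pos_iff.2 hx
    rw [← Real.rpow_mul hp.le, ← Real.rpow_add hp]; congr 1; ring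
  set w' : EuclideanSpace ℝ (Fin n) → ℝ := fun x => w x - B * ‖x‖ ^ (-h + σ * μ) with hw'
  set H₁ : EuclideanSpace ℝ (Fin n) → ℝ := fun x =>
    A * ρ ^ (τ - μ) * ‖x‖ ^ (-h + σ * μ) - A * ‖x‖ ^ (-h + σ * τ) with hH₁
  have hH₁pos : ∀ x ≠ 0, ‖x‖ ^ σ ≤ ρ → 0 ≤ H₁ x := by
    intro x hx hxρ
    have h1 : (‖x‖ ^ σ) ^ (τ - μ) ≤ ρ ^ (τ - μ) :=
      Real.rpow_le_rpow (by positivity) hxρ (by linarith)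
    have h2 : H₁ x = A * ‖x‖ ^ (-h + σ * μ) * (ρ ^ (τ - μ) - (‖x‖ ^ σ) ^ (τ - μ)) := by
      simp only [hH₁, hsplit x hx]; ring
    rw [h2]
    exact mul_nonneg (by positivity) (by linarith)
  have key := le_of_lap_comparison_end (n := n) hσ (c := ρ) (S := univ) isClosed_univ (w := w')
    (H₁ := H₁) (H₂ := fun x => ‖x‖ ^ (-h + σ * -μ))
    (fun x hx => (hw x hx).sub (contDiffAt_const.mul (hN _ x hx)))
    (fun x hx => (contDiffAt_const.mul (hN _ x hx)).sub (contDiffAt_const.mul (hN _ x hx)))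
    (fun x hx => hN _ x hx) (fun x hx hxρ _ => hH₁pos x hx hxρ)
    (fun x hx => by have := norm_pos_iff.2 hx; positivity) ?_ ?_ (by simp) ?_
  · intro x hx hxρ
    have h1 := key x hx hxρ (mem_univ x)
    have h2 : 0 ≤ A * ‖x‖ ^ (-h + σ * τ) := by positivity
    simp only [hw', hH₁] at h1
    linarith
  · intro η hη
    obtain ⟨ε₁, hε₁, h1⟩ := hend (η / 2) (by positivity)
    obtain ⟨ε₂, hε₂, h2⟩ := norm_rpow_le_of_end (n := n) (h := h) (σ := σ) hμ
      (η := η / (2 * (|B| + 1))) (by positivity)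
    refine ⟨min ε₁ ε₂, by positivity, fun x hx hxε => ?_⟩
    have h3 := h1 x hx (hxε.trans (min_le_left _ _))
    have h4 := h2 x hx (hxε.trans (min_le_right _ _))
    have h5 : -B * ‖x‖ ^ (-h + σ * μ) ≤ (|B| + 1) * ‖x‖ ^ (-h + σ * μ) := by
      gcongr
      linarith [neg_abs_le B]
    have h6 : (|B| + 1) * ‖x‖ ^ (-h + σ * μ) ≤ η / 2 * ‖x‖ ^ (-h + σ * -μ) := by
      calc _ ≤ (|B| + 1) * (η / (2 * (|B| + 1)) * ‖x‖ ^ (-h + σ * -μ)) := by gcongr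
        _ = _ := by field_simp
    have h7 := le_abs_self (w x)
    simp only [hw']
    linarith
  · intro x hx hxρ _
    have h1 := hB x hx hxρ
    have h2 := hH₁pos x hx hxρ.le
    simp only [hw']
    linarith
  · intro η hη x hx hxρ _ hlt
    have hp := norm_pos_iff.2 hx
    have hLw : lap n w' x = -(h ^ 2 - μ ^ 2) * w' x / ‖x‖ ^ 2 - f x := by
      rw [hw', lap_sub (hw x hx) (contDiffAt_const.mul (hN _ x hx)), lap_const_mul B (hN _ x hx),
        lap_norm_rpow_of_sign hn hσ _ hx, hlap x hx]
      ring
    have hLH : lap n H₁ x + η * lap n (fun x => ‖x‖ ^ (-h + σ * -μ)) x =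
        -(h ^ 2 - μ ^ 2) * (H₁ x + η * ‖x‖ ^ (-h + σ * -μ)) / ‖x‖ ^ 2
          - A * (τ ^ 2 - μ ^ 2) * ‖x‖ ^ (-h + σ * τ) / ‖x‖ ^ 2 := by
      rw [hH₁, lap_sub (contDiffAt_const.mul (hN _ x hx)) (contDiffAt_const.mul (hN _ x hx)),
        lap_const_mul _ (hN _ x hx), lap_const_mul _ (hN _ x hx),
        lap_norm_rpow_of_sign hn hσ _ hx, lap_norm_rpow_of_sign hn hσ _ hx,
        lap_norm_rpow_of_sign hn hσ _ hx]
      ring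
    refine mul_lt_mul_of_source_lt hLw hLH.le ((hf x hx (hxρ.trans hρc)).trans_lt ?_) ?_ hlt
    · gcongr
    · have := hH₁pos x hx hxρ
      positivity

/-- Solutions become radial at the end, to higher order. -/
theorem exists_sub_le_of_norm_eq {h μ τ σ c C : ℝ} (hn3 : 3 ≤ n) (hn : (n : ℝ) = 2 * h + 2)
    (hσ : σ = 1 ∨ σ = -1) (hτ : τ ^ 2 - μ ^ 2 ≤ 1 / 3) (hc : 0 < c) (hC : 0 ≤ C)
    {w f : EuclideanSpace ℝ (Fin n) → ℝ}
    (hw : ∀ x ≠ 0, ContDiffAt ℝ 2 w x)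
    (hlap : ∀ x ≠ 0, lap n w x = -(h ^ 2 - μ ^ 2) * w x / ‖x‖ ^ 2 - f x)
    (hf : ∀ x ≠ 0, ‖x‖ ^ σ ≤ c → |f x| ≤ C * ‖x‖ ^ (-h + σ * τ) / ‖x‖ ^ 2)
    (hend : ∀ η > 0, ∃ ε > 0, ∀ x ≠ 0, ‖x‖ ^ σ ≤ ε → |w x| ≤ η * ‖x‖ ^ (-h + σ * -μ)) :
    ∃ A > 0, ∀ x ≠ 0, ‖x‖ ^ σ ≤ c → ∀ y, ‖x‖ = ‖y‖ →
      w x - w y ≤ A * ‖x‖ ^ (-h + σ * τ) := by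
  obtain ⟨B, hB, hBw⟩ := exists_bound_on_sphere hw hσ hc (-h + σ * τ)
  refine ⟨3 * (2 * B + 2 * C + 1), by positivity, fun x hx hxc y hxy => ?_⟩
  set A := 2 * B + 2 * C + 1 with hA
  have hApos : 0 < A := by positivity
  rcases eq_or_ne x y with rfl | hne
  · simp only [sub_self]; positivity
  have hsub : x - y ≠ 0 := sub_ne_zero.2 hne
  have hnsub : ‖x - y‖ ≠ 0 := norm_ne_zero_iff.2 hsub
  set e : EuclideanSpace ℝ (Fin n) := ‖x - y‖⁻¹ • (x - y) with he
  have hen : ‖e‖ = 1 := by rw [he, norm_smul, norm_inv, norm_norm, inv_mul_cancel₀ hnsub]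
  have hxe : 0 ≤ ⟪x, e⟫ := by
    rw [he, inner_smul_right, inner_sub_right, real_inner_self_eq_norm_sq]
    have := real_inner_le_norm x y
    rw [← hxy] at this
    exact mul_nonneg (by positivity) (by nlinarith)
  set R := (ℝ ∙ (x - y))ᗮ.reflection with hR
  have hRx : R x = y := Submodule.reflection_sub hxy
  have hRfix : ∀ z, ⟪z, e⟫ = 0 → R z = z := by
    intro z hz
    apply Submodule.reflection_mem_subspace_eq_self
    rw [Submodule.mem_orthogonal_singleton_iff_inner_left]
    rw [he, inner_smul_right] at hz
    exact (mul_eq_zero.1 hz).resolve_left (inv_ne_zero hnsub)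
  have hRn : ∀ z, ‖R z‖ = ‖z‖ := R.norm_map
  have hR0 : ∀ z, z ≠ 0 → R z ≠ 0 := fun z hz => by
    rw [← norm_ne_zero_iff, hRn]; exact norm_ne_zero_iff.2 hz
  have hwR : ∀ z ≠ 0, ContDiffAt ℝ 2 (fun z => w (R z)) z := fun z hz =>
    (hw _ (hR0 z hz)).comp z R.toContinuousLinearEquiv.contDiff.contDiffAt
  set S : Set (EuclideanSpace ℝ (Fin n)) := {z | 0 ≤ ⟪z, e⟫} with hSdef
  have hcont : Continuous fun z : EuclideanSpace ℝ (Fin n) => ⟪z, e⟫ :=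
    continuous_id.inner continuous_const
  have hbar : ∀ z ≠ 0, ContDiffAt ℝ 2 (halfSpaceBarrier e (-h + σ * τ)) z := fun z hz =>
    contDiffAt_halfSpaceBarrier e _ hz
  have hbarpos : ∀ z ≠ 0, z ∈ S → 0 < halfSpaceBarrier e (-h + σ * τ) z := fun z hz hzS => by
    have := norm_pos_iff.2 hz
    exact (by positivity : 0 < ‖z‖ ^ (-h + σ * τ)).trans_le (le_halfSpaceBarrier hen _ hz hzS)
  have key := le_of_lap_comparison_end (n := n) hσ (c := c) (S := S)
    (isClosed_le continuous_const hcont) (w := fun z => w z - w (R z))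
    (H₁ := fun z => A * halfSpaceBarrier e (-h + σ * τ) z) (H₂ := fun z => ‖z‖ ^ (-h + σ * -μ))
    (fun z hz => (hw z hz).sub (hwR z hz)) (fun z hz => contDiffAt_const.mul (hbar z hz))
    (fun z hz => contDiffAt_norm_rpow _ hz) (fun z hz _ hzS => (mul_pos hApos (hbarpos z hz hzS)).le)
    (fun z hz => by have := norm_pos_iff.2 hz; positivity) ?_ ?_ ?_ ?_ x hx hxc hxe
  · have h1 := halfSpaceBarrier_le hen (-h + σ * τ) hx hxe
    rw [hRx] at key
    nlinarith
  · intro η hη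
    obtain ⟨ε, hε, h1⟩ := hend (η / 2) (by positivity)
    refine ⟨ε, hε, fun z hz hzε => ?_⟩
    have h2 := h1 z hz hzε
    have h3 := h1 (R z) (hR0 z hz) (by rwa [hRn])
    rw [hRn] at h3
    have := le_abs_self (w z)
    have := neg_abs_le (w (R z))
    linarith
  · intro z hz hzc hzS
    have h2 := hBw z hz hzc
    have h3 := hBw (R z) (hR0 z hz) (by rwa [hRn])
    rw [hRn] at h3
    have h4 := le_abs_self (w z)
    have h5 := neg_abs_le (w (R z))
    have h6 := le_halfSpaceBarrier hen (-h + σ * τ) hz hzS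
    have h7 : A * ‖z‖ ^ (-h + σ * τ) ≤ A * halfSpaceBarrier e (-h + σ * τ) z := by gcongr
    have h8 : 0 ≤ (2 * C + 1) * ‖z‖ ^ (-h + σ * τ) := by positivity
    have h9 : A * ‖z‖ ^ (-h + σ * τ) = 2 * (B * ‖z‖ ^ (-h + σ * τ))
      + (2 * C + 1) * ‖z‖ ^ (-h + σ * τ) := by rw [hA]; ring
    linarith
  · intro z hz hzc hzS hzi
    have h1 : ⟪z, e⟫ = 0 := by
      by_contra hne0
      refine hzi (mem_interior.2 ⟨{z | 0 < ⟪z, e⟫}, fun z hz => le_of_lt (α := ℝ) hz,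
        isOpen_lt continuous_const hcont, lt_of_le_of_ne hzS (Ne.symm hne0)⟩)
    rw [hRfix z h1, sub_self]
    exact (mul_pos hApos (hbarpos z hz hzS)).le
  · intro η hη z hz hzc hzS hlt
    have hp := norm_pos_iff.2 hz
    have hLw : lap n (fun z => w z - w (R z)) z =
        -(h ^ 2 - μ ^ 2) * (w z - w (R z)) / ‖z‖ ^ 2 - (f z - f (R z)) := by
      rw [lap_sub (hw z hz) (hwR z hz), lap_comp_linearIsometryEquiv R (hw _ (hR0 z hz)),
        hlap z hz, hlap _ (hR0 z hz), hRn]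
      ring
    have hge := le_halfSpaceBarrier hen (-h + σ * τ) hz hzS
    have hle := halfSpaceBarrier_le hen (-h + σ * τ) hz hzS
    have hLbar : lap n (halfSpaceBarrier e (-h + σ * τ)) z ≤
        -(h ^ 2 - μ ^ 2) * halfSpaceBarrier e (-h + σ * τ) z / ‖z‖ ^ 2
          - ‖z‖ ^ (-h + σ * τ) / ‖z‖ ^ 2 := by
      refine (lap_halfSpaceBarrier_le hn3 hen _ hz hzS).trans ?_
      have e1 : (-h + σ * τ) * (-h + σ * τ + n - 2) = τ ^ 2 - h ^ 2 := by
        rw [hn]; rcases hσ with rfl | rfl <;> ring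
      rw [e1, ← sub_div]
      refine div_le_div_of_nonneg_right ?_ (by positivity)
      have hp1 := hbarpos z hz hzS
      have : (τ ^ 2 - μ ^ 2) * halfSpaceBarrier e (-h + σ * τ) z ≤
        1 / 3 * halfSpaceBarrier e (-h + σ * τ) z := by gcongr
      linarith
    have hLH : lap n (fun z => A * halfSpaceBarrier e (-h + σ * τ) z) z
        + η * lap n (fun x => ‖x‖ ^ (-h + σ * -μ)) z ≤
        -(h ^ 2 - μ ^ 2) * (A * halfSpaceBarrier e (-h + σ * τ) z + η * ‖z‖ ^ (-h + σ * -μ))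
          / ‖z‖ ^ 2 - A * (‖z‖ ^ (-h + σ * τ) / ‖z‖ ^ 2) := by
      rw [lap_const_mul A (hbar z hz), lap_norm_rpow_of_sign hn hσ _ hz]
      have := mul_le_mul_of_nonneg_left hLbar hApos.le
      refine (add_le_add_left this _).trans (le_of_eq ?_)
      ring
    refine mul_lt_mul_of_source_lt hLw hLH ?_ ?_ hlt
    · have h1 := hf z hz hzc
      have h2 := hf (R z) (hR0 z hz) (by rwa [hRn])
      rw [hRn] at h2
      refine (abs_sub _ _).trans_lt ?_
      have h3 : 0 < ‖z‖ ^ (-h + σ * τ) / ‖z‖ ^ 2 := by positivity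
      rw [mul_div_assoc] at h1 h2
      have h4 : A * (‖z‖ ^ (-h + σ * τ) / ‖z‖ ^ 2) = 2 * (C * (‖z‖ ^ (-h + σ * τ) / ‖z‖ ^ 2))
        + (2 * B + 1) * (‖z‖ ^ (-h + σ * τ) / ‖z‖ ^ 2) := by rw [hA]; ring
      have h5 : 0 < (2 * B + 1) * (‖z‖ ^ (-h + σ * τ) / ‖z‖ ^ 2) := by positivity
      linarith
    · have := hbarpos z hz hzS
      positivity

end LinearAsymptotics

section MeanValue

open scoped RealInnerProductSpace
open Metric

variable {n : ℕ}

/-- The truncated paraboloid `(1 - |z|²)₊`. -/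
noncomputable def paraboloid (z : EuclideanSpace ℝ (Fin n)) : ℝ := max (1 - ‖z‖ ^ 2) 0

theorem continuous_paraboloid : Continuous (paraboloid (n := n)) := by
  unfold paraboloid; fun_prop

theorem paraboloid_nonneg (z : EuclideanSpace ℝ (Fin n)) : 0 ≤ paraboloid z := le_max_right _ _

theorem paraboloid_le_one (z : EuclideanSpace ℝ (Fin n)) : paraboloid z ≤ 1 :=
  max_le (by nlinarith [norm_nonneg z]) zero_le_one

theorem paraboloid_eq_zero {z : EuclideanSpace ℝ (Fin n)} (hz : z ∉ closedBall 0 1) :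
    paraboloid z = 0 := by
  rw [mem_closedBall_zero_iff, not_le] at hz
  exact max_eq_right (by nlinarith)

theorem hasDerivAt_max_zero_sq (t : ℝ) :
    HasDerivAt (fun t : ℝ => max t 0 ^ 2) (2 * max t 0) t := by
  rcases lt_trichotomy t 0 with ht | rfl | ht
  · rw [max_eq_right ht.le, mul_zero]
    refine (hasDerivAt_const t (0 : ℝ)).congr_of_eventuallyEq ?_
    filter_upwards [eventually_lt_nhds ht] with s hs
    simp [max_eq_right hs.le]
  · rw [max_self, mul_zero]
    rw [hasDerivAt_iff_isLittleO]
    have h1 : (fun t : ℝ => max t 0 ^ 2) =O[nhds 0] fun t : ℝ => t ^ 2 := by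
      refine Asymptotics.IsBigO.of_bound 1 (Eventually.of_forall fun t => ?_)
      rw [one_mul, Real.norm_eq_abs, Real.norm_eq_abs, abs_pow, abs_pow]
      refine pow_le_pow_left₀ (abs_nonneg _) ?_ 2
      rw [abs_of_nonneg (le_max_right _ _)]
      exact max_le (le_abs_self t) (abs_nonneg t)
    have h2 : (fun t : ℝ => t ^ 2) =o[nhds 0] fun t : ℝ => t := by
      simpa using Asymptotics.isLittleO_pow_pow (𝕜 := ℝ) (m := 1) (n := 2) (by norm_num)
    simpa using h1.trans_isLittleO h2
  · rw [max_eq_left ht.le]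
    have h := hasDerivAt_pow 2 t
    simp only [Nat.cast_ofNat, Nat.add_one_sub_one, pow_one] at h
    refine h.congr_of_eventuallyEq ?_
    filter_upwards [eventually_gt_nhds ht] with s hs
    simp [max_eq_left (le_of_lt hs)]

theorem hasFDerivAt_paraboloid_sq (z : EuclideanSpace ℝ (Fin n)) :
    HasFDerivAt (fun z : EuclideanSpace ℝ (Fin n) => paraboloid z ^ 2 / 4)
      (-(paraboloid z • innerSL ℝ z)) z := by
  have h1 : HasFDerivAt (fun y : EuclideanSpace ℝ (Fin n) => 1 - ‖y‖ ^ 2)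
      (-(2 • innerSL ℝ z)) z := (hasStrictFDerivAt_norm_sq z).hasFDerivAt.const_sub 1
  have h2 := ((hasDerivAt_max_zero_sq (1 - ‖z‖ ^ 2)).comp_hasFDerivAt z h1).mul_const (1 / 4 : ℝ)
  refine (h2.congr_fderiv ?_).congr_of_eventuallyEq (Eventually.of_forall fun y => ?_)
  · ext v
    simp only [paraboloid, smul_apply, neg_apply, smul_eq_mul, nsmul_eq_mul]
    push_cast; ring
  · simp only [paraboloid, Function.comp]; ring

theorem integrable_mul_of_eq_zero {g ψ : EuclideanSpace ℝ (Fin n) → ℝ}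
    (hg : ContinuousOn g (closedBall 0 1)) (hψ : Continuous ψ)
    (h0 : ∀ z ∉ closedBall (0 : EuclideanSpace ℝ (Fin n)) 1, ψ z = 0) :
    Integrable fun z => g z * ψ z := by
  rw [← integrableOn_iff_integrable_of_support_subset (s := closedBall 0 1)]
  · exact (hg.mul hψ.continuousOn).integrableOn_compact (isCompact_closedBall _ _)
  · intro z hz
    by_contra h
    exact hz (by simp [h0 z h])

theorem integral_fderiv_mul_paraboloid {φ : EuclideanSpace ℝ (Fin n) → ℝ}
    (hφ : ∀ z ∈ closedBall (0 : EuclideanSpace ℝ (Fin n)) 1, ContDiffAt ℝ 2 φ z) :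
    ∫ z, fderiv ℝ φ z z * paraboloid z = ∫ z, lap n φ z * (paraboloid z ^ 2 / 4) := by
  have hd : ∀ z ∈ closedBall (0 : EuclideanSpace ℝ (Fin n)) 1, ContDiffAt ℝ 1 (fderiv ℝ φ) z :=
    fun z hz => (hφ z hz).fderiv_right (by norm_num)
  have hdi : ∀ v, ∀ z ∈ closedBall (0 : EuclideanSpace ℝ (Fin n)) 1,
      ContDiffAt ℝ 1 (fun y => fderiv ℝ φ y v) z :=
    fun v z hz => (hd z hz).clm_apply contDiffAt_const
  have hddi : ∀ v, ContinuousOn (fun z => fderiv ℝ (fun y => fderiv ℝ φ y v) z v)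
      (closedBall (0 : EuclideanSpace ℝ (Fin n)) 1) := fun v z hz =>
    (((hdi v z hz).fderiv_right (m := 0) (by norm_num)).continuousAt.clm_apply
      continuousAt_const).continuousWithinAt
  have hΨc : Continuous fun z : EuclideanSpace ℝ (Fin n) => paraboloid z ^ 2 / 4 :=
    (continuous_paraboloid.pow 2).div_const 4
  have hΨ0 : ∀ z ∉ closedBall (0 : EuclideanSpace ℝ (Fin n)) 1, paraboloid z ^ 2 / 4 = 0 :=
    fun z hz => by rw [paraboloid_eq_zero hz]; norm_num
  have hts : tsupport (fun z : EuclideanSpace ℝ (Fin n) => paraboloid z ^ 2 / 4) ⊆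
      closedBall 0 1 := by
    refine closure_minimal (fun z hz => ?_) isClosed_closedBall
    by_contra h
    exact hz (hΨ0 z h)
  have hfd : ∀ z v : EuclideanSpace ℝ (Fin n),
      fderiv ℝ (fun z : EuclideanSpace ℝ (Fin n) => paraboloid z ^ 2 / 4) z v =
        -(⟪z, v⟫ * paraboloid z) := fun z v => by
    rw [(hasFDerivAt_paraboloid_sq z).fderiv]
    simp [mul_comm]
  have hint1 : ∀ v, Integrable fun z : EuclideanSpace ℝ (Fin n) =>
      fderiv ℝ φ z v * ⟪z, v⟫ * paraboloid z := fun v =>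
    integrable_mul_of_eq_zero (ContinuousOn.mul
      (fun z hz => (hdi v z hz).continuousAt.continuousWithinAt)
      (continuous_id.inner continuous_const).continuousOn) continuous_paraboloid
      (fun z hz => paraboloid_eq_zero hz)
  have hint2 : ∀ v, Integrable fun z : EuclideanSpace ℝ (Fin n) =>
      fderiv ℝ (fun y => fderiv ℝ φ y v) z v * (paraboloid z ^ 2 / 4) := fun v =>
    integrable_mul_of_eq_zero (hddi v) hΨc hΨ0
  have hparts : ∀ v : EuclideanSpace ℝ (Fin n),
      ∫ z, fderiv ℝ φ z v * ⟪z, v⟫ * paraboloid z =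
      ∫ z, fderiv ℝ (fun y => fderiv ℝ φ y v) z v * (paraboloid z ^ 2 / 4) := fun v => by
    have h := integral_mul_fderiv_eq_neg_fderiv_mul_of_integrable (μ := volume)
      (f := fun z : EuclideanSpace ℝ (Fin n) => paraboloid z ^ 2 / 4)
      (g := fun z => fderiv ℝ φ z v) (v := v) ?_ ?_ ?_
      (fun z _ => (hasFDerivAt_paraboloid_sq z).differentiableAt)
      (fun z hz => (hdi v z (hts hz)).differentiableAt (by norm_num))
    · simp only [hfd] at h
      rw [← integral_neg] at h
      have e1 : ∀ z, -(-(⟪z, v⟫ * paraboloid z) * fderiv ℝ φ z v) =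
          fderiv ℝ φ z v * ⟪z, v⟫ * paraboloid z := fun z => by ring
      simp only [e1, mul_comm (paraboloid _ ^ 2 / 4)] at h
      exact h.symm
    · refine (hint1 v).neg.congr (Eventually.of_forall fun z => ?_)
      simp only [hfd, Pi.neg_apply]; ring
    · refine (hint2 v).congr (Eventually.of_forall fun z => mul_comm _ _)
    · refine (integrable_mul_of_eq_zero (fun z hz =>
        (hdi v z hz).continuousAt.continuousWithinAt) hΨc hΨ0).congr
        (Eventually.of_forall fun z => mul_comm _ _)
  have hsum : ∀ z : EuclideanSpace ℝ (Fin n), fderiv ℝ φ z z * paraboloid z =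
      ∑ i, fderiv ℝ φ z (EuclideanSpace.single i 1) *
        ⟪z, EuclideanSpace.single i (1 : ℝ)⟫ * paraboloid z := fun z => by
    have h := (EuclideanSpace.basisFun (Fin n) ℝ).sum_repr z
    have h2 := congrArg (fderiv ℝ φ z) h
    simp only [EuclideanSpace.basisFun_repr, EuclideanSpace.basisFun_apply, map_sum, map_smul,
      smul_eq_mul] at h2
    rw [← h2, Finset.sum_mul]
    refine Finset.sum_congr rfl fun i _ => ?_
    have h3 : ⟪z, EuclideanSpace.single i (1 : ℝ)⟫ = z i := by
      rw [EuclideanSpace.inner_single_right]; simp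
    rw [h3, mul_comm (z i)]
  simp only [hsum, lap, Finset.sum_mul]
  rw [integral_finsetSum _ fun i _ => hint1 _, integral_finsetSum _ fun i _ => hint2 _]
  exact Finset.sum_congr rfl fun i _ => hparts _

theorem lap_comp_add_smul (φ : EuclideanSpace ℝ (Fin n) → ℝ) (x : EuclideanSpace ℝ (Fin n)) (r : ℝ)
    (z : EuclideanSpace ℝ (Fin n)) :
    lap n (fun z => φ (x + r • z)) z = r ^ 2 * lap n φ (x + r • z) := by
  have h1 : ∀ (f : EuclideanSpace ℝ (Fin n) → ℝ) (z v : EuclideanSpace ℝ (Fin n)),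
      fderiv ℝ (fun z => f (x + r • z)) z v = r * fderiv ℝ f (x + r • z) v := fun f z v => by
    have h2 := fderiv_comp_smul (𝕜 := ℝ) (f := fun y => f (x + y)) (x := z) r
    rw [fderiv_comp_add_left] at h2
    rw [h2]; rfl
  simp only [lap, h1, Finset.mul_sum]
  refine Finset.sum_congr rfl fun i _ => ?_
  have h3 : (fun y => r * fderiv ℝ φ (x + r • y) (EuclideanSpace.single i 1)) =
      r • (fun y => fderiv ℝ φ (x + r • y) (EuclideanSpace.single i 1)) := rfl
  rw [h3, fderiv_const_smul_field, Pi.smul_apply, smul_apply,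
    h1 (fun y => fderiv ℝ φ y (EuclideanSpace.single i 1)), smul_eq_mul]
  ring

theorem smul_mem_closedBall_of_abs_le {r R : ℝ} (hr : |r| ≤ R) {z : EuclideanSpace ℝ (Fin n)}
    (hz : z ∈ closedBall (0 : EuclideanSpace ℝ (Fin n)) 1) :
    r • z ∈ closedBall (0 : EuclideanSpace ℝ (Fin n)) R := by
  rw [mem_closedBall_zero_iff] at hz ⊢
  rw [norm_smul, Real.norm_eq_abs]
  nlinarith [abs_nonneg r, norm_nonneg z]

theorem hasDerivAt_integral_mul_paraboloid {φ : EuclideanSpace ℝ (Fin n) → ℝ} {r R : ℝ}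
    (hr : |r| < R)
    (hφ : ∀ z ∈ closedBall (0 : EuclideanSpace ℝ (Fin n)) R, ContDiffAt ℝ 2 φ z) :
    HasDerivAt (fun r : ℝ => ∫ z, φ (r • z) * paraboloid z)
      (∫ z, fderiv ℝ φ (r • z) z * paraboloid z) r := by
  have hfc : ContinuousOn (fderiv ℝ φ) (closedBall 0 R) := fun z hz =>
    ((hφ z hz).fderiv_right (m := 0) (by norm_num)).continuousAt.continuousWithinAt
  obtain ⟨L, hL⟩ := (isCompact_closedBall (0 : EuclideanSpace ℝ (Fin n)) R).exists_bound_of_continuousOn hfc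
  have hφc : ∀ t : ℝ, |t| ≤ R → ContinuousOn (fun z : EuclideanSpace ℝ (Fin n) => φ (t • z))
      (closedBall 0 1) := fun t ht z hz =>
    ((hφ _ (smul_mem_closedBall_of_abs_le ht hz)).continuousAt.comp
      (continuous_const_smul t).continuousAt).continuousWithinAt
  have hInt : ∀ t : ℝ, |t| ≤ R → Integrable fun z : EuclideanSpace ℝ (Fin n) =>
      φ (t • z) * paraboloid z := fun t ht =>
    integrable_mul_of_eq_zero (hφc t ht) continuous_paraboloid fun z hz => paraboloid_eq_zero hz
  have hs : {t : ℝ | |t| < R} ∈ nhds r := (isOpen_lt continuous_abs continuous_const).mem_nhds hr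
  refine (hasDerivAt_integral_of_dominated_loc_of_deriv_le (s := {t : ℝ | |t| < R})
    (bound := fun z => L * paraboloid z) (F' := fun t z => fderiv ℝ φ (t • z) z * paraboloid z)
    hs ?_ (hInt r hr.le) ?_ ?_ ?_ ?_).2
  · filter_upwards [hs] with t ht using (hInt t (le_of_lt ht)).aestronglyMeasurable
  · refine (integrable_mul_of_eq_zero (fun z hz => ?_) continuous_paraboloid
      fun z hz => paraboloid_eq_zero hz).aestronglyMeasurable
    exact ((((hφ _ (smul_mem_closedBall_of_abs_le hr.le hz)).fderiv_right (m := 0)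
      (by norm_num)).continuousAt.comp (continuous_const_smul r).continuousAt).clm_apply
      continuousAt_id).continuousWithinAt
  · refine Eventually.of_forall fun z t ht => ?_
    by_cases hz : z ∈ closedBall (0 : EuclideanSpace ℝ (Fin n)) 1
    · have h1 := hL _ (smul_mem_closedBall_of_abs_le (le_of_lt ht) hz)
      rw [mem_closedBall_zero_iff] at hz
      rw [norm_mul, Real.norm_of_nonneg (paraboloid_nonneg z)]
      refine mul_le_mul_of_nonneg_right ?_ (paraboloid_nonneg z)
      refine (ContinuousLinearMap.le_opNorm _ _).trans ?_
      nlinarith [norm_nonneg (fderiv ℝ φ (t • z))]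
    · simp [paraboloid_eq_zero hz]
  · exact integrable_mul_of_eq_zero continuousOn_const continuous_paraboloid
      fun z hz => paraboloid_eq_zero hz
  · refine Eventually.of_forall fun z t ht => ?_
    by_cases hz : z ∈ closedBall (0 : EuclideanSpace ℝ (Fin n)) 1
    · have h1 := ((hφ _ (smul_mem_closedBall_of_abs_le (le_of_lt ht) hz)).differentiableAt
        (by norm_num)).hasFDerivAt
      have h2 : HasDerivAt (fun t : ℝ => t • z) z t := by
        simpa using (hasDerivAt_id t).smul_const z
      exact (h1.comp_hasDerivAt t h2).mul_const _
    · simpa [paraboloid_eq_zero hz] using hasDerivAt_const t (0 : ℝ)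

theorem abs_integral_mul_paraboloid_sub_le {φ : EuclideanSpace ℝ (Fin n) → ℝ} {R Λ : ℝ}
    (hR : 1 < R)
    (hφ : ∀ z ∈ closedBall (0 : EuclideanSpace ℝ (Fin n)) R, ContDiffAt ℝ 2 φ z)
    (hΛ : ∀ z ∈ closedBall (0 : EuclideanSpace ℝ (Fin n)) 1, |lap n φ z| ≤ Λ) :
    |(∫ z, φ z * paraboloid z) - φ 0 * ∫ z : EuclideanSpace ℝ (Fin n), paraboloid z| ≤
      Λ * ∫ z : EuclideanSpace ℝ (Fin n), paraboloid z ^ 2 / 4 := by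
  have hder := fun (r : ℝ) (hr : |r| < R) => hasDerivAt_integral_mul_paraboloid hr hφ
  obtain ⟨r, hr, hslope⟩ := exists_hasDerivAt_eq_slope
    (fun r : ℝ => ∫ z, φ (r • z) * paraboloid z)
    (fun r => ∫ z, fderiv ℝ φ (r • z) z * paraboloid z) zero_lt_one
    (fun r hr => (hder r (by rw [abs_of_nonneg hr.1]; linarith [hr.2])).continuousAt.continuousWithinAt)
    (fun r hr => hder r (by rw [abs_of_nonneg hr.1.le]; linarith [hr.2]))
  simp only [one_smul, zero_smul, sub_zero, div_one, integral_const_mul] at hslope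
  rw [← hslope]
  have hr1 : |r| ≤ 1 := by rw [abs_of_nonneg hr.1.le]; exact hr.2.le
  have h1 := integral_fderiv_mul_paraboloid (φ := fun z => φ (0 + r • z)) fun z hz => by
    simp only [zero_add]
    exact (hφ _ (smul_mem_closedBall_of_abs_le (hr1.trans hR.le) hz)).comp z
      (contDiff_const_smul r).contDiffAt
  have h2 : ∀ z v, fderiv ℝ (fun z => φ (r • z)) z v = r * fderiv ℝ φ (r • z) v := fun z v => by
    have h2 := fderiv_comp_smul (𝕜 := ℝ) (f := φ) (x := z) r
    rw [h2]; rfl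
  simp only [lap_comp_add_smul] at h1
  simp only [zero_add, h2, mul_assoc, integral_const_mul] at h1
  have h3 : ∫ z, fderiv ℝ φ (r • z) z * paraboloid z =
      r * ∫ z, lap n φ (r • z) * (paraboloid z ^ 2 / 4) := by
    apply mul_left_cancel₀ hr.1.ne'
    rw [h1]; ring
  have hInt : Integrable fun z : EuclideanSpace ℝ (Fin n) => Λ * (paraboloid z ^ 2 / 4) :=
    integrable_mul_of_eq_zero continuousOn_const ((continuous_paraboloid.pow 2).div_const 4)
      fun z hz => by rw [paraboloid_eq_zero hz]; norm_num
  have h4 : |∫ z, lap n φ (r • z) * (paraboloid z ^ 2 / 4)| ≤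
      ∫ z : EuclideanSpace ℝ (Fin n), Λ * (paraboloid z ^ 2 / 4) := by
    refine norm_integral_le_of_norm_le (f := fun z => lap n φ (r • z) * (paraboloid z ^ 2 / 4)) hInt
      (Eventually.of_forall fun z => ?_)
    have h5 : (0 : ℝ) ≤ paraboloid z ^ 2 / 4 := by positivity
    rw [norm_mul, Real.norm_of_nonneg h5]
    by_cases hz : z ∈ closedBall (0 : EuclideanSpace ℝ (Fin n)) 1
    · exact mul_le_mul_of_nonneg_right (hΛ _ (smul_mem_closedBall_of_abs_le hr1 hz)) h5
    · simp [paraboloid_eq_zero hz]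
  rw [h3, abs_mul, ← integral_const_mul]
  exact (mul_le_of_le_one_left (abs_nonneg _) hr1).trans h4

theorem setIntegral_comp_add_smul (g : EuclideanSpace ℝ (Fin n) → ℝ) (x : EuclideanSpace ℝ (Fin n))
    {ρ : ℝ} (hρ : 0 < ρ) :
    ∫ z in closedBall 0 1, g (x + ρ • z) = (ρ ^ n)⁻¹ * ∫ y in closedBall x ρ, g y := by
  have h1 := Measure.setIntegral_comp_smul_of_pos volume (fun y => g (x + y))
    (closedBall (0 : EuclideanSpace ℝ (Fin n)) 1) hρ
  have h2 := (measurePreserving_add_left (volume : Measure (EuclideanSpace ℝ (Fin n)))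
    x).setIntegral_preimage_emb (measurableEmbedding_addLeft x) g (closedBall x ρ)
  have h3 : (fun y => x + y) ⁻¹' closedBall x ρ = closedBall 0 ρ := by ext; simp [dist_eq_norm]
  rw [h3] at h2
  rw [h1, smul_unitClosedBall_of_nonneg hρ.le, h2, finrank_euclideanSpace_fin, smul_eq_mul]

theorem integral_paraboloid_pos : 0 < ∫ z : EuclideanSpace ℝ (Fin n), paraboloid z := by
  have hi : Integrable (paraboloid (n := n)) := by
    simpa using integrable_mul_of_eq_zero (continuousOn_const (c := (1 : ℝ))) continuous_paraboloid
      fun z hz => paraboloid_eq_zero hz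
  refine continuous_paraboloid.integral_pos_of_hasCompactSupport_nonneg_nonzero
    (HasCompactSupport.intro (isCompact_closedBall 0 1) fun z hz => paraboloid_eq_zero hz)
    paraboloid_nonneg (x := 0) (by simp [paraboloid])

/-- A local `L^p` to `L^∞` bound for functions with small Laplacian. -/
theorem exists_rpow_mul_pow_le_setIntegral (n : ℕ) {p : ℝ} (hp : 1 < p) :
    ∃ κ > 0, ∃ C > 0, ∀ (u : EuclideanSpace ℝ (Fin n) → ℝ) (x : EuclideanSpace ℝ (Fin n))
      (ρ R Λ : ℝ), 0 < ρ → ρ < R → (∀ y ∈ closedBall x R, ContDiffAt ℝ 2 u y) →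
      (∀ y ∈ closedBall x ρ, |lap n u y| ≤ Λ) → Λ * ρ ^ 2 ≤ κ * |u x| →
      |u x| ^ p * ρ ^ n ≤ C * ∫ y in closedBall x ρ, |u y| ^ p := by
  set I := ∫ z : EuclideanSpace ℝ (Fin n), paraboloid z with hI
  set J := ∫ z : EuclideanSpace ℝ (Fin n), paraboloid z ^ 2 / 4 with hJ
  have hIpos : 0 < I := integral_paraboloid_pos
  have hJnn : 0 ≤ J := integral_nonneg fun z => by positivity
  refine ⟨I / (4 * (J + 1)), by positivity, 2 * 4 ^ (p - 1) / I, by positivity, ?_⟩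
  intro u x ρ R Λ hρ hρR hu hΛ hsmall
  set M := |u x| with hM
  have hE : 0 ≤ ∫ y in closedBall x ρ, |u y| ^ p :=
    integral_nonneg fun y => by positivity
  rcases (abs_nonneg (u x)).eq_or_lt with h0 | hMpos
  · rw [← hM] at h0
    rw [← h0, Real.zero_rpow (by linarith), zero_mul]
    positivity
  rw [← hM] at hMpos
  set φ : EuclideanSpace ℝ (Fin n) → ℝ := fun z => u (x + ρ • z) with hφdef
  have hmem : ∀ (r : ℝ) (z : EuclideanSpace ℝ (Fin n)), z ∈ closedBall (0 : EuclideanSpace ℝ (Fin n)) r →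
      x + ρ • z ∈ closedBall x (ρ * r) := fun r z hz => by
    rw [mem_closedBall_zero_iff] at hz
    rw [mem_closedBall_iff_norm, add_sub_cancel_left, norm_smul, Real.norm_of_nonneg hρ.le]
    gcongr
  have hφ : ∀ z ∈ closedBall (0 : EuclideanSpace ℝ (Fin n)) (R / ρ), ContDiffAt ℝ 2 φ z :=
    fun z hz => by
      have h1 := hu (x + ρ • z) (by have := hmem _ z hz; rwa [mul_div_cancel₀ _ hρ.ne'] at this)
      exact h1.comp z (contDiff_const.add (contDiff_const_smul ρ)).contDiffAt
  have hR : 1 < R / ρ := by rwa [lt_div_iff₀ hρ, one_mul]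
  have hmv := abs_integral_mul_paraboloid_sub_le hR hφ (Λ := Λ * ρ ^ 2) fun z hz => by
    rw [hφdef, lap_comp_add_smul, abs_mul, abs_of_nonneg (by positivity), mul_comm]
    have := hΛ (x + ρ • z) (by simpa using hmem 1 z hz)
    gcongr
  have hφc : ContinuousOn φ (closedBall 0 1) := fun z hz =>
    (hφ z (closedBall_subset_closedBall hR.le hz)).continuousAt.continuousWithinAt
  have hInt : IntegrableOn (fun z => |φ z| ^ p) (closedBall 0 1) :=
    ((hφc.abs).rpow_const fun z _ => Or.inr (by linarith)).integrableOn_compact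
      (isCompact_closedBall _ _)
  have hψint : Integrable (paraboloid (n := n)) := by
    simpa using integrable_mul_of_eq_zero (continuousOn_const (c := (1 : ℝ))) continuous_paraboloid
      fun z hz => paraboloid_eq_zero hz
  set b := (M / 4) ^ (1 - p) with hb
  have hbpos : 0 < b := by positivity
  have hpt : ∀ z, |φ z| * paraboloid z ≤ M / 4 * paraboloid z +
      (closedBall (0 : EuclideanSpace ℝ (Fin n)) 1).indicator (fun z => b * |φ z| ^ p) z := by
    intro z
    by_cases hz : z ∈ closedBall (0 : EuclideanSpace ℝ (Fin n)) 1
    · rw [indicator_of_mem hz]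
      have h0 := paraboloid_nonneg z
      have h1 := paraboloid_le_one z
      have h2 : 0 ≤ b * |φ z| ^ p := by positivity
      rcases le_or_gt |φ z| (M / 4) with h | h
      · nlinarith
      · have h3 : |φ z| ≤ b * |φ z| ^ p := by
          have h4 : 1 ≤ (|φ z| / (M / 4)) ^ (p - 1) :=
            Real.one_le_rpow ((one_le_div (by positivity)).2 h.le) (by linarith)
          have h5 : b * |φ z| ^ p = |φ z| * (|φ z| / (M / 4)) ^ (p - 1) := by
            have hφp : 0 < |φ z| := by linarith
            rw [Real.div_rpow hφp.le (by positivity), hb, ← neg_sub, Real.rpow_neg (by positivity)]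
            have : |φ z| ^ p = |φ z| * |φ z| ^ (p - 1) := by
              rw [Real.rpow_sub_one hφp.ne']; field_simp
            rw [this]; ring
          rw [h5]
          exact le_mul_of_one_le_right (abs_nonneg _) h4
        nlinarith
    · rw [indicator_of_notMem hz, paraboloid_eq_zero hz]; simp
  have hle : ∫ z, |φ z| * paraboloid z ≤ M / 4 * I + b * ((ρ ^ n)⁻¹ * ∫ y in closedBall x ρ, |u y| ^ p) := by
    have hi2 : Integrable ((closedBall (0 : EuclideanSpace ℝ (Fin n)) 1).indicator
      (fun z => b * |φ z| ^ p)) := (integrable_indicator_iff isClosed_closedBall.measurableSet).2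
        (hInt.const_mul b)
    refine (integral_mono (integrable_mul_of_eq_zero hφc.abs continuous_paraboloid
      fun z hz => paraboloid_eq_zero hz) ((hψint.const_mul _).add hi2) hpt).trans (le_of_eq ?_)
    simp only [Pi.add_apply]
    rw [integral_add (hψint.const_mul _) hi2, integral_const_mul,
      integral_indicator isClosed_closedBall.measurableSet, integral_const_mul,
      ← setIntegral_comp_add_smul (fun y => |u y| ^ p) x hρ]
  have habs : |∫ z, φ z * paraboloid z| ≤ ∫ z, |φ z| * paraboloid z := by
    refine (abs_integral_le_integral_abs).trans (le_of_eq ?_)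
    simp only [abs_mul, abs_of_nonneg (paraboloid_nonneg _)]
  have hφ0 : |φ 0 * I| = M * I := by
    rw [abs_mul, abs_of_pos hIpos, hφdef]; simp [hM]
  have hJ' : Λ * ρ ^ 2 * J ≤ M * I / 4 := by
    calc Λ * ρ ^ 2 * J ≤ I / (4 * (J + 1)) * M * J := by gcongr
      _ = M * I / 4 * (J / (J + 1)) := by field_simp
      _ ≤ M * I / 4 * 1 := by
        gcongr
        rw [div_le_one (by positivity)]; linarith
      _ = _ := mul_one _
  have htri : |φ 0 * I| ≤ |∫ z, φ z * paraboloid z| + |(∫ z, φ z * paraboloid z) - φ 0 * I| := by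
    have := abs_sub_abs_le_abs_sub (φ 0 * I) (∫ z, φ z * paraboloid z)
    rw [abs_sub_comm] at this
    linarith
  have hfin : M * I / 2 ≤ b * ((ρ ^ n)⁻¹ * ∫ y in closedBall x ρ, |u y| ^ p) := by linarith
  have hb' : b * (M / 4) ^ (p - 1) = 1 := by
    rw [hb, ← Real.rpow_add (by positivity)]; simp
  have hMp : M ^ p = 4 ^ (p - 1) * ((M / 4) ^ (p - 1) * M) := by
    rw [Real.div_rpow hMpos.le (by norm_num), Real.rpow_sub_one hMpos.ne']
    field_simp
  have hρn : 0 < ρ ^ n := by positivity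
  calc M ^ p * ρ ^ n = 2 * 4 ^ (p - 1) / I * (M / 4) ^ (p - 1) * ρ ^ n * (M * I / 2) := by
        rw [hMp]; field_simp
    _ ≤ 2 * 4 ^ (p - 1) / I * (M / 4) ^ (p - 1) * ρ ^ n *
        (b * ((ρ ^ n)⁻¹ * ∫ y in closedBall x ρ, |u y| ^ p)) := by gcongr
    _ = 2 * 4 ^ (p - 1) / I * (b * (M / 4) ^ (p - 1)) * (ρ ^ n * (ρ ^ n)⁻¹) *
        ∫ y in closedBall x ρ, |u y| ^ p := by ring
    _ = _ := by rw [hb', mul_inv_cancel₀ hρn.ne', mul_one, mul_one]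

end MeanValue

section Decay

open Metric

variable {n : ℕ}

/-- Smallness of the scale-invariant `L^p` norm gives a scale-invariant pointwise bound. -/
theorem exists_rpow_le_setIntegral_closedBall {h q s G : ℝ} (hn : (n : ℝ) = 2 * h + 2) (hh : 0 < h)
    (hs : 0 < s) (hq : 0 < q) (hqs : h * q = 2 - s) (hG : 0 ≤ G)
    {u : EuclideanSpace ℝ (Fin n) → ℝ} (hu : ∀ x ≠ 0, ContDiffAt ℝ 2 u x)
    (hlap : ∀ x ≠ 0, |lap n u x| ≤ G * |u x| / ‖x‖ ^ 2 + |u x| ^ (q + 1) / ‖x‖ ^ s) :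
    ∃ ε > 0, ∃ C > 0, ∀ x ≠ 0, ∫ y in closedBall x (‖x‖ / 2), |u y| ^ (n / h : ℝ) < ε →
      (‖x‖ ^ h * |u x|) ^ (n / h : ℝ) ≤ C * ∫ y in closedBall x (‖x‖ / 2), |u y| ^ (n / h : ℝ) := by
  set p : ℝ := n / h with hp
  have hp1 : 1 < p := by rw [hp, one_lt_div hh]; linarith
  have hhp : h * p = n := by rw [hp]; field_simp
  obtain ⟨κ, hκ, C, hC, hmain⟩ := exists_rpow_mul_pow_le_setIntegral n hp1
  set C₁ := G * 2 ^ h + (2 ^ h) ^ (q + 1) with hC₁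
  have hC₁pos : 0 < C₁ := by positivity
  set k := min (κ / C₁) (1 / 16) with hk
  have hkpos : 0 < k := by positivity
  set C₂ := C * (2 / k) ^ (h + 1) with hC₂
  have hC₂pos : 0 < C₂ := by positivity
  refine ⟨1 / C₂, by positivity, 2 ^ (n : ℝ) * C₂, by positivity, fun x₀ hx₀ hE => ?_⟩
  set E := ∫ y in closedBall x₀ (‖x₀‖ / 2), |u y| ^ p with hEdef
  have hEnn : 0 ≤ E := integral_nonneg fun y => by positivity
  have hr := norm_pos_iff.2 hx₀
  set r := ‖x₀‖ with hrdef
  have hball : ∀ y ∈ closedBall x₀ (r / 2), r / 2 ≤ ‖y‖ := fun y hy => by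
    rw [mem_closedBall_iff_norm'] at hy
    have := norm_sub_norm_le x₀ y
    linarith
  have hne : ∀ y ∈ closedBall x₀ (r / 2), y ≠ 0 := fun y hy => by
    have := hball y hy
    exact norm_pos_iff.1 (by linarith)
  have hucont : ContinuousOn u (closedBall x₀ (r / 2)) := fun y hy =>
    (hu y (hne y hy)).continuousAt.continuousWithinAt
  obtain ⟨x₁, hx₁, hmax⟩ := (isCompact_closedBall x₀ (r / 2)).exists_isMaxOn
    ⟨x₀, mem_closedBall_self (by positivity)⟩
    (f := fun y => |u y| * (r / 2 - dist y x₀) ^ h)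
    (hucont.abs.mul (ContinuousOn.rpow_const (by fun_prop) fun y _ => Or.inr hh.le))
  set M := |u x₁| with hM
  set d := r / 2 - dist x₁ x₀ with hd
  have hdnn : 0 ≤ d := by rw [mem_closedBall] at hx₁; linarith
  have hdr : d ≤ r / 2 := by have := dist_nonneg (x := x₁) (y := x₀); linarith
  set N := M * d ^ h with hN
  have hNmax : ∀ y ∈ closedBall x₀ (r / 2), |u y| * (r / 2 - dist y x₀) ^ h ≤ N := fun y hy => hmax hy
  have hNnn : 0 ≤ N := by positivity
  suffices hNE : N ^ p ≤ C₂ * E by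
    have h1 := hNmax x₀ (mem_closedBall_self (by positivity))
    rw [dist_self, sub_zero, Real.div_rpow hr.le (by norm_num)] at h1
    have h2 : r ^ h * |u x₀| ≤ 2 ^ h * N := by
      calc r ^ h * |u x₀| = 2 ^ h * (|u x₀| * (r ^ h / 2 ^ h)) := by field_simp
        _ ≤ _ := by gcongr
    calc (r ^ h * |u x₀|) ^ p ≤ (2 ^ h * N) ^ p :=
          Real.rpow_le_rpow (by positivity) h2 (by linarith)
      _ = 2 ^ (n : ℝ) * N ^ p := by
          rw [Real.mul_rpow (by positivity) hNnn, ← Real.rpow_mul (by norm_num), hhp]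
      _ ≤ 2 ^ (n : ℝ) * C₂ * E := by rw [mul_assoc]; gcongr
  rcases hNnn.eq_or_lt with hN0 | hNpos
  · rw [← hN0, Real.zero_rpow (by linarith)]; positivity
  have hdpos : 0 < d := by
    refine hdnn.lt_of_ne fun h0 => ?_
    rw [hN, ← h0, Real.zero_rpow hh.ne', mul_zero] at hNpos
    exact lt_irrefl _ hNpos
  have hMpos : 0 < M := pos_of_mul_pos_left hNpos (by positivity)
  set T := 1 + N ^ q with hT
  have hTpos : 1 ≤ T := by have : 0 ≤ N ^ q := by positivity
                           linarith
  set θ := Real.sqrt (k / T) with hθ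
  have hθ2 : θ ^ 2 = k / T := Real.sq_sqrt (by positivity)
  have hθpos : 0 < θ := Real.sqrt_pos.2 (by positivity)
  have hθle : θ ≤ 1 / 4 := by
    refine abs_le_of_sq_le_sq' ?_ (by norm_num) |>.2
    rw [hθ2, div_le_iff₀ (by positivity)]
    have : k ≤ 1 / 16 := min_le_right _ _
    linarith
  have hsub : closedBall x₁ (d / 2) ⊆ closedBall x₀ (r / 2) := fun y hy => by
    rw [mem_closedBall] at hy ⊢
    have := dist_triangle y x₁ x₀
    linarith
  have huM : ∀ y ∈ closedBall x₁ (d / 2), |u y| ≤ 2 ^ h * M := fun y hy => by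
    have h1 := hNmax y (hsub hy)
    have h2 : d / 2 ≤ r / 2 - dist y x₀ := by
      rw [mem_closedBall] at hy
      have := dist_triangle y x₁ x₀
      linarith
    have h3 : |u y| * (d / 2) ^ h ≤ M * d ^ h := by
      refine le_trans ?_ h1
      exact mul_le_mul_of_nonneg_left (Real.rpow_le_rpow (by positivity) h2 hh.le) (abs_nonneg _)
    rw [Real.div_rpow hdnn (by norm_num), ← mul_div_assoc, div_le_iff₀ (by positivity)] at h3
    exact le_of_mul_le_mul_right (h3.trans_eq (by ring)) (by positivity : 0 < d ^ h)
  have hρR : θ * d < d / 2 := by linarith [mul_le_mul_of_nonneg_right hθle hdnn]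
  set Λ := G * (2 ^ h * M) / (r / 2) ^ 2 + (2 ^ h * M) ^ (q + 1) / (r / 2) ^ s with hΛ
  have hΛbd : ∀ y ∈ closedBall x₁ (θ * d), |lap n u y| ≤ Λ := fun y hy => by
    have hy' := closedBall_subset_closedBall hρR.le hy
    have h1 := huM y hy'
    have h2 := hball y (hsub hy')
    refine (hlap y (hne y (hsub hy'))).trans ?_
    rw [hΛ]
    gcongr
  have hNq : N ^ q = M ^ q * d ^ (2 - s) := by
    rw [hN, Real.mul_rpow hMpos.le (by positivity), ← Real.rpow_mul hdnn, hqs]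
  have hΛd : Λ * d ^ 2 ≤ C₁ * T * M := by
    have h1 : d ^ 2 / (r / 2) ^ 2 ≤ 1 := by
      rw [← div_pow]
      exact pow_le_one₀ (by positivity) ((div_le_one (by positivity)).2 hdr)
    have h2 : d ^ 2 / (r / 2) ^ s ≤ d ^ (2 - s) := by
      rw [Real.rpow_sub hdpos, Real.rpow_two]
      gcongr
    have h3 : (2 ^ h * M) ^ (q + 1) = (2 ^ h) ^ (q + 1) * M ^ q * M := by
      rw [Real.mul_rpow (by positivity) hMpos.le, Real.rpow_add_one hMpos.ne', mul_assoc]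
    have h4 : (0 : ℝ) ≤ (2 ^ h) ^ (q + 1) := by positivity
    have h5 : 0 ≤ G * 2 ^ h := by positivity
    have h6 : 0 ≤ N ^ q := by positivity
    calc Λ * d ^ 2 = G * 2 ^ h * M * (d ^ 2 / (r / 2) ^ 2) +
          (2 ^ h) ^ (q + 1) * M ^ q * M * (d ^ 2 / (r / 2) ^ s) := by rw [hΛ, h3]; ring
      _ ≤ G * 2 ^ h * M * 1 + (2 ^ h) ^ (q + 1) * M ^ q * M * d ^ (2 - s) := by gcongr
      _ = (G * 2 ^ h + (2 ^ h) ^ (q + 1) * N ^ q) * M := by rw [hNq]; ring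
      _ ≤ C₁ * T * M := by
        gcongr
        have h7 : C₁ * T = G * 2 ^ h + (2 ^ h) ^ (q + 1) * N ^ q
          + (G * 2 ^ h * N ^ q + (2 ^ h) ^ (q + 1)) := by rw [hC₁, hT]; ring
        rw [h7]
        exact le_add_of_nonneg_right (add_nonneg (mul_nonneg h5 h6) h4)
  have hsmall : Λ * (θ * d) ^ 2 ≤ κ * |u x₁| := by
    calc Λ * (θ * d) ^ 2 = Λ * d ^ 2 * (k / T) := by rw [mul_pow, hθ2]; ring
      _ ≤ C₁ * T * M * (k / T) := by gcongr
      _ = C₁ * k * M := by field_simp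
      _ ≤ C₁ * (κ / C₁) * M := by gcongr; exact min_le_left _ _
      _ = κ * |u x₁| := by rw [mul_div_cancel₀ _ hC₁pos.ne']
  have hInt : IntegrableOn (fun y => |u y| ^ p) (closedBall x₀ (r / 2)) :=
    (hucont.abs.rpow_const fun z _ => Or.inr (by linarith)).integrableOn_compact
      (isCompact_closedBall _ _)
  have hres := hmain u x₁ (θ * d) (d / 2) Λ (by positivity) hρR
    (fun y hy => hu y (hne y (hsub hy))) hΛbd hsmall
  have hEle : ∫ y in closedBall x₁ (θ * d), |u y| ^ p ≤ E :=
    setIntegral_mono_set hInt (Eventually.of_forall fun y => by positivity)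
      (Eventually.of_forall fun y hy => hsub (closedBall_subset_closedBall hρR.le hy))
  have hNp : M ^ p * (θ * d) ^ n = N ^ p * (k / T) ^ (h + 1) := by
    rw [hN, Real.mul_rpow hMpos.le (by positivity), ← Real.rpow_mul hdnn, hhp, ← hθ2,
      ← Real.rpow_natCast θ 2, ← Real.rpow_mul hθpos.le, mul_pow, Real.rpow_natCast,
      ← Real.rpow_natCast θ n, hn]
    push_cast
    ring_nf
  have hkey : N ^ p ≤ C * E * (T / k) ^ (h + 1) := by
    have h1 : N ^ p * (k / T) ^ (h + 1) ≤ C * E := by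
      rw [← hNp]; exact hres.trans (by gcongr)
    have h2 : (k / T) ^ (h + 1) * (T / k) ^ (h + 1) = 1 := by
      rw [← Real.mul_rpow (by positivity) (by positivity), div_mul_div_cancel₀ (by positivity),
        div_self hkpos.ne', Real.one_rpow]
    calc N ^ p = N ^ p * (k / T) ^ (h + 1) * (T / k) ^ (h + 1) := by rw [mul_assoc, h2, mul_one]
      _ ≤ _ := by gcongr
  rcases le_or_gt N 1 with hN1 | hN1
  · have h1 : T ≤ 2 := by
      have := Real.rpow_le_one hNnn hN1 hq.le
      linarith
    calc N ^ p ≤ C * E * (T / k) ^ (h + 1) := hkey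
      _ ≤ C * E * (2 / k) ^ (h + 1) := by gcongr
      _ = C₂ * E := by rw [hC₂]; ring
  · exfalso
    have h1 : T ≤ 2 * N ^ q := by
      have := Real.one_le_rpow hN1.le hq.le
      linarith
    have h2 : N ^ p ≤ C₂ * E * N ^ (q * (h + 1)) := by
      calc N ^ p ≤ C * E * (T / k) ^ (h + 1) := hkey
        _ ≤ C * E * (2 / k * N ^ q) ^ (h + 1) := by
          gcongr
          rw [div_mul_eq_mul_div]
          gcongr
        _ = _ := by
          rw [Real.mul_rpow (by positivity) (by positivity), ← Real.rpow_mul hNnn, hC₂]; ring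
    have h3 : C₂ * E < 1 := by rwa [lt_div_iff₀ hC₂pos, mul_comm] at hE
    have h4 : q * (h + 1) ≤ p := by
      have : h * (q * (h + 1)) ≤ h * p := by
        rw [hhp, hn, ← mul_assoc, hqs]
        linarith [mul_pos hs (by positivity : 0 < h + 1)]
      exact le_of_mul_le_mul_left this hh
    have h5 : N ^ (q * (h + 1)) ≤ N ^ p := Real.rpow_le_rpow_of_exponent_le hN1.le h4
    have h6 : 0 < N ^ (q * (h + 1)) := by positivity
    linarith [mul_lt_mul_of_pos_right h3 h6]

theorem norm_rpow_sign_le_two_mul {E : Type*} [NormedAddCommGroup E] {σ : ℝ} (hσ : σ = 1 ∨ σ = -1)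
    {x y : E} (hx : x ≠ 0) (hy : y ∈ closedBall x (‖x‖ / 2)) :
    y ≠ 0 ∧ ‖y‖ ^ σ ≤ 2 * ‖x‖ ^ σ := by
  have hp := norm_pos_iff.2 hx
  rw [mem_closedBall_iff_norm] at hy
  have h1 := norm_sub_norm_le y x
  have h2 := norm_sub_norm_le x y
  rw [norm_sub_rev] at h2
  have hy0 : 0 < ‖y‖ := by linarith
  refine ⟨norm_pos_iff.1 hy0, ?_⟩
  rcases hσ with rfl | rfl
  · simp only [Real.rpow_one]; linarith
  · simp only [Real.rpow_neg_one]
    rw [← div_eq_mul_inv, inv_eq_one_div, div_le_div_iff₀ hy0 hp]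
    linarith

theorem exists_setIntegral_closedBall_lt {σ : ℝ} (hσ : σ = 1 ∨ σ = -1)
    {g : EuclideanSpace ℝ (Fin n) → ℝ} (hg : Integrable g) (hg0 : ∀ x, 0 ≤ g x)
    {δ : ℝ} (hδ : 0 < δ) :
    ∃ ρ > 0, ∀ x ≠ 0, ‖x‖ ^ σ ≤ ρ → ∫ y in closedBall x (‖x‖ / 2), g y < δ := by
  set S : ℕ → Set (EuclideanSpace ℝ (Fin n)) :=
    fun k => {y | y ≠ 0 ∧ ‖y‖ ^ σ ≤ 2 * (1 / ((k : ℝ) + 1))} with hS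
  have hSm : ∀ k, MeasurableSet (S k) := fun k => by
    have h1 : Measurable fun y : EuclideanSpace ℝ (Fin n) => ‖y‖ ^ σ :=
      measurable_norm.pow_const σ
    exact (measurableSet_singleton 0).compl.inter (measurableSet_le h1 measurable_const)
  have hanti : Antitone S := fun i j hij y hy => ⟨hy.1, hy.2.trans (by gcongr)⟩
  have hlim := tendsto_setIntegral_of_antitone hSm hanti ⟨0, hg.integrableOn⟩
  have hempty : ⋂ k, S k = ∅ := by
    refine eq_empty_of_forall_notMem fun y hy => ?_
    rw [mem_iInter] at hy
    have hp : 0 < ‖y‖ ^ σ := by have := norm_pos_iff.2 (hy 0).1; positivity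
    obtain ⟨k, hk⟩ := exists_nat_one_div_lt (half_pos hp)
    have := (hy k).2
    linarith
  rw [hempty, setIntegral_empty] at hlim
  obtain ⟨k, hk⟩ := (hlim.eventually (eventually_lt_nhds hδ)).exists
  refine ⟨1 / ((k : ℝ) + 1), by positivity, fun x hx hxk => lt_of_le_of_lt ?_ hk⟩
  refine setIntegral_mono_set hg.integrableOn (Eventually.of_forall hg0)
    (Eventually.of_forall fun y hy => ?_)
  have h1 := norm_rpow_sign_le_two_mul hσ hx hy
  exact ⟨h1.1, h1.2.trans (by gcongr)⟩

theorem exists_norm_rpow_mul_abs_le {h q s G σ : ℝ} (hn : (n : ℝ) = 2 * h + 2) (hh : 0 < h)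
    (hσ : σ = 1 ∨ σ = -1)
    (hs : 0 < s) (hq : 0 < q) (hqs : h * q = 2 - s) (hG : 0 ≤ G)
    {u : EuclideanSpace ℝ (Fin n) → ℝ} (hu : ∀ x ≠ 0, ContDiffAt ℝ 2 u x)
    (hlap : ∀ x ≠ 0, |lap n u x| ≤ G * |u x| / ‖x‖ ^ 2 + |u x| ^ (q + 1) / ‖x‖ ^ s)
    (hInt : Integrable fun x => |u x| ^ (n / h : ℝ)) {η : ℝ} (hη : 0 < η) :
    ∃ ρ > 0, ∀ x ≠ 0, ‖x‖ ^ σ ≤ ρ → ‖x‖ ^ h * |u x| ≤ η := by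
  obtain ⟨ε, hε, C, hC, hmain⟩ := exists_rpow_le_setIntegral_closedBall hn hh hs hq hqs hG hu hlap
  have hp : (0 : ℝ) < n / h := by rw [hn]; positivity
  obtain ⟨ρ, hρ, h1⟩ := exists_setIntegral_closedBall_lt hσ hInt (fun x => by positivity)
    (δ := min ε (η ^ (n / h : ℝ) / C)) (by positivity)
  refine ⟨ρ, hρ, fun x hx hxρ => ?_⟩
  have h2 := h1 x hx hxρ
  have h3 := hmain x hx (h2.trans_le (min_le_left _ _))
  have h4 := h2.trans_le (min_le_right _ _)
  rw [lt_div_iff₀ hC, mul_comm] at h4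
  exact (Real.rpow_le_rpow_iff (by positivity) hη.le hp).1 (h3.trans h4.le)

end Decay

section EndAsymptotics

variable {n : ℕ}

theorem norm_rpow_mul_norm_rpow_sign {E : Type*} [NormedAddCommGroup E] {x : E} (hx : x ≠ 0)
    (h μ σ τ : ℝ) :
    ‖x‖ ^ (h - σ * μ) * ‖x‖ ^ (-h + σ * τ) = (‖x‖ ^ σ) ^ (τ - μ) := by
  rw [← Real.rpow_add (norm_pos_iff.2 hx), ← Real.rpow_mul (norm_nonneg x)]
  congr 1; ring

/-- A function that oscillates little on `{‖x‖ ^ σ ≤ ρ}` has a limit at the end `‖x‖ ^ σ → 0`. -/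
theorem exists_limit_of_oscillation [NeZero n] {σ c A δ : ℝ} (hσ : σ = 1 ∨ σ = -1) (hc : 0 < c)
    (hδ : 0 < δ) {v : EuclideanSpace ℝ (Fin n) → ℝ}
    (hv : ∀ x ≠ 0, ‖x‖ ^ σ ≤ c → ∀ y ≠ 0, ‖y‖ ^ σ ≤ ‖x‖ ^ σ → |v y - v x| ≤ A * (‖x‖ ^ σ) ^ δ) :
    ∃ K : ℝ, ∀ x ≠ 0, ‖x‖ ^ σ ≤ c → |v x - K| ≤ A * (‖x‖ ^ σ) ^ δ := by
  set r : ℕ → ℝ := fun k => c * (1 / 2) ^ k with hr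
  have hr0 : ∀ k, 0 < r k := fun k => by positivity
  have hanti : Antitone r := fun k l hkl =>
    mul_le_mul_of_nonneg_left (pow_le_pow_of_le_one (by norm_num) (by norm_num) hkl) hc.le
  have hrc : ∀ k, r k ≤ c := fun k => by simpa [hr] using hanti (Nat.zero_le k)
  have hrlim : Tendsto r atTop (nhds 0) := by
    simpa [hr] using (tendsto_pow_atTop_nhds_zero_of_lt_one (r := (1 / 2 : ℝ)) (by norm_num)
      (by norm_num)).const_mul c
  set z : ℕ → EuclideanSpace ℝ (Fin n) := fun k => EuclideanSpace.single 0 (r k ^ σ) with hz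
  have hznorm : ∀ k, ‖z k‖ = r k ^ σ := fun k => by
    rw [hz, PiLp.norm_single, Real.norm_of_nonneg (by have := hr0 k; positivity)]
  have hz0 : ∀ k, z k ≠ 0 := fun k => norm_pos_iff.1 (by rw [hznorm]; have := hr0 k; positivity)
  have hzσ : ∀ k, ‖z k‖ ^ σ = r k := fun k => by
    rw [hznorm, ← Real.rpow_mul (hr0 k).le]
    rcases hσ with rfl | rfl <;> norm_num
  have hlim : Tendsto (fun k => 2 * (A * r k ^ δ)) atTop (nhds 0) := by
    have h1 := ((hrlim.rpow_const (Or.inr hδ.le)).const_mul A).const_mul 2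
    simpa [Real.zero_rpow hδ.ne'] using h1
  have hcau : CauchySeq fun k => v (z k) := by
    refine cauchySeq_of_le_tendsto_0 _ (fun k l N hk hl => ?_) hlim
    have h1 : ∀ k, N ≤ k → |v (z k) - v (z N)| ≤ A * r N ^ δ := fun k hk => by
      have := hv (z N) (hz0 N) (by rw [hzσ]; exact hrc N) (z k) (hz0 k)
        (by rw [hzσ, hzσ]; exact hanti hk)
      rwa [hzσ] at this
    rw [Real.dist_eq]
    have h2 := abs_le.1 (h1 k hk)
    have h3 := abs_le.1 (h1 l hl)
    exact abs_le.2 ⟨by linarith, by linarith⟩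
  obtain ⟨K, hK⟩ := cauchySeq_tendsto_of_complete hcau
  refine ⟨K, fun x hx hxc => ?_⟩
  have hxp : 0 < ‖x‖ ^ σ := by have := norm_pos_iff.2 hx; positivity
  rw [abs_sub_comm]
  refine le_of_tendsto (hK.sub_const (v x)).abs ?_
  filter_upwards [hrlim.eventually_le_const hxp] with k hk
  exact hv x hx hxc (z k) (hz0 k) (by rwa [hzσ])

theorem exists_oscillation_le {h μ τ σ c C : ℝ} (hn3 : 3 ≤ n) (hn : (n : ℝ) = 2 * h + 2)
    (hσ : σ = 1 ∨ σ = -1) (hμ : 0 < μ) (hτ : μ < τ) (hτ' : τ ^ 2 - μ ^ 2 ≤ 1 / 3)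
    (hc : 0 < c) (hC : 0 ≤ C) {w f : EuclideanSpace ℝ (Fin n) → ℝ}
    (hw : ∀ x ≠ 0, ContDiffAt ℝ 2 w x)
    (hlap : ∀ x ≠ 0, lap n w x = -(h ^ 2 - μ ^ 2) * w x / ‖x‖ ^ 2 - f x)
    (hf : ∀ x ≠ 0, ‖x‖ ^ σ ≤ c → |f x| ≤ C * ‖x‖ ^ (-h + σ * τ) / ‖x‖ ^ 2)
    (hend : ∀ η > 0, ∃ ε > 0, ∀ x ≠ 0, ‖x‖ ^ σ ≤ ε → |w x| ≤ η * ‖x‖ ^ (-h + σ * -μ)) :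
    ∃ A > 0, ∀ x ≠ 0, ‖x‖ ^ σ ≤ c → ∀ y ≠ 0, ‖y‖ ^ σ ≤ ‖x‖ ^ σ →
      ‖y‖ ^ (h - σ * μ) * w y - ‖x‖ ^ (h - σ * μ) * w x ≤ A * (‖x‖ ^ σ) ^ (τ - μ) := by
  obtain ⟨A₁, hA₁, h1⟩ := exists_sphere_bound_propagates hn hσ hμ hτ hC hw hlap hf hend
  obtain ⟨A₂, hA₂, h2⟩ := exists_sub_le_of_norm_eq hn3 hn hσ hτ' hc hC hw hlap hf hend
  refine ⟨A₂ + A₁, by positivity, fun x hx hxc y hy hyx => ?_⟩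
  have hxp := norm_pos_iff.2 hx
  have hyp := norm_pos_iff.2 hy
  have hone : ∀ z : EuclideanSpace ℝ (Fin n), z ≠ 0 →
      ‖z‖ ^ (h - σ * μ) * ‖z‖ ^ (-h + σ * μ) = 1 := fun z hz => by
    rw [norm_rpow_mul_norm_rpow_sign hz, sub_self, Real.rpow_zero]
  have h3 := h1 (‖x‖ ^ σ) (by positivity) hxc
    (‖x‖ ^ (h - σ * μ) * w x + A₂ * (‖x‖ ^ σ) ^ (τ - μ)) (fun z hz hzx => ?_) y hy hyx
  · have h4 := mul_le_mul_of_nonneg_left h3 (by positivity : 0 ≤ ‖y‖ ^ (h - σ * μ))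
    rw [mul_left_comm, hone y hy, mul_one] at h4
    linarith
  · have hzn : ‖z‖ = ‖x‖ := by
      have := congrArg (fun t : ℝ => t ^ σ) hzx
      simp only [← Real.rpow_mul (norm_nonneg _)] at this
      rcases hσ with rfl | rfl <;> norm_num at this <;> exact this
    have h4 := h2 z hz (hzx.trans_le hxc) x hzn
    have h5 : ‖z‖ ^ (-h + σ * τ) = (‖x‖ ^ σ) ^ (τ - μ) * ‖x‖ ^ (-h + σ * μ) := by
      rw [hzn, ← Real.rpow_mul hxp.le, ← Real.rpow_add hxp]; congr 1; ring
    have h6 : ‖x‖ ^ (h - σ * μ) * w x * ‖x‖ ^ (-h + σ * μ) = w x := by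
      rw [mul_right_comm, hone x hx, one_mul]
    rw [hzn, add_mul, h6]
    rw [h5] at h4
    linarith

/-- Solutions of the Hardy equation with a source of higher order behave like `K ‖x‖ ^ (-h + σ μ)`
at the end, once the slowly decaying mode is excluded. -/
theorem exists_limit_of_hardy_source {h μ τ σ c C : ℝ} (hn3 : 3 ≤ n) (hn : (n : ℝ) = 2 * h + 2)
    (hσ : σ = 1 ∨ σ = -1) (hμ : 0 < μ) (hτ : μ < τ) (hτ' : τ ^ 2 - μ ^ 2 ≤ 1 / 3)
    (hc : 0 < c) (hC : 0 ≤ C) {w f : EuclideanSpace ℝ (Fin n) → ℝ}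
    (hw : ∀ x ≠ 0, ContDiffAt ℝ 2 w x)
    (hlap : ∀ x ≠ 0, lap n w x = -(h ^ 2 - μ ^ 2) * w x / ‖x‖ ^ 2 - f x)
    (hf : ∀ x ≠ 0, ‖x‖ ^ σ ≤ c → |f x| ≤ C * ‖x‖ ^ (-h + σ * τ) / ‖x‖ ^ 2)
    (hend : ∀ η > 0, ∃ ε > 0, ∀ x ≠ 0, ‖x‖ ^ σ ≤ ε → |w x| ≤ η * ‖x‖ ^ (-h + σ * -μ)) :
    ∃ K A : ℝ, ∀ x ≠ 0, ‖x‖ ^ σ ≤ c →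
      |‖x‖ ^ (h - σ * μ) * w x - K| ≤ A * (‖x‖ ^ σ) ^ (τ - μ) := by
  have : NeZero n := ⟨by lia⟩
  obtain ⟨A₁, hA₁, h1⟩ := exists_oscillation_le hn3 hn hσ hμ hτ hτ' hc hC hw hlap hf hend
  obtain ⟨A₂, hA₂, h2⟩ := exists_oscillation_le (w := fun x => -w x) (f := fun x => -f x)
    hn3 hn hσ hμ hτ hτ' hc hC (fun x hx => (hw x hx).neg)
    (fun x hx => by rw [lap_neg (hw x hx), hlap x hx]; ring)
    (fun x hx hxc => by rw [abs_neg]; exact hf x hx hxc)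
    (fun η hη => by simpa only [abs_neg] using hend η hη)
  obtain ⟨K, hK⟩ := exists_limit_of_oscillation (A := A₁ + A₂) hσ hc (sub_pos.2 hτ)
    (v := fun x => ‖x‖ ^ (h - σ * μ) * w x) (fun x hx hxc y hy hyx => by
      have h3 := h1 x hx hxc y hy hyx
      have h4 := h2 x hx hxc y hy hyx
      have h5 : 0 < (‖x‖ ^ σ) ^ (τ - μ) := by have := norm_pos_iff.2 hx; positivity
      have h6 := mul_pos hA₁ h5
      have h7 := mul_pos hA₂ h5
      exact abs_le.2 ⟨by linarith, by linarith⟩)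
  exact ⟨K, A₁ + A₂, hK⟩

/-- Improved decay at an end for the critical Hardy–Sobolev equation. -/
theorem exists_abs_le_of_hardySobolev {h μ ν q s σ : ℝ} (hn : (n : ℝ) = 2 * h + 2) (hh : 0 < h)
    (hσ : σ = 1 ∨ σ = -1) (hν : 0 < ν) (hνμ : ν < μ)
    (hs : 0 < s) (hq : 0 < q) (hqs : h * q = 2 - s)
    {u : EuclideanSpace ℝ (Fin n) → ℝ} (hu : ∀ x ≠ 0, ContDiffAt ℝ 2 u x)
    (hlap : ∀ x ≠ 0, lap n u x = -(h ^ 2 - μ ^ 2) * u x / ‖x‖ ^ 2 - |u x| ^ q * u x / ‖x‖ ^ s)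
    (hInt : Integrable fun x => |u x| ^ (n / h : ℝ)) :
    ∃ c > 0, c ≤ 1 ∧ ∃ A > 0, ∀ x ≠ 0, ‖x‖ ^ σ ≤ c → |u x| ≤ A * ‖x‖ ^ (-h + σ * ν) := by
  have hsmall : ∀ η > 0, ∃ ρ > 0, ∀ x ≠ 0, ‖x‖ ^ σ ≤ ρ → ‖x‖ ^ h * |u x| ≤ η := fun η hη => by
    refine exists_norm_rpow_mul_abs_le (G := |h ^ 2 - μ ^ 2|) hn hh hσ hs hq hqs (abs_nonneg _) hu
      (fun x hx => ?_) hInt hη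
    have hxp := norm_pos_iff.2 hx
    rw [hlap x hx]
    refine (abs_sub _ _).trans (le_of_eq ?_)
    rw [abs_div, abs_div, abs_mul, abs_mul, abs_neg, abs_of_nonneg (sq_nonneg ‖x‖),
      abs_of_nonneg (by positivity : (0 : ℝ) ≤ |u x| ^ q),
      abs_of_nonneg (by positivity : (0 : ℝ) ≤ ‖x‖ ^ s),
      Real.rpow_add_of_nonneg (abs_nonneg _) hq.le zero_le_one, Real.rpow_one]
  set P : EuclideanSpace ℝ (Fin n) → ℝ := fun x => (‖x‖ ^ h * |u x|) ^ q with hP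
  have hPeq : ∀ x ≠ 0, |u x| ^ q / ‖x‖ ^ s = P x / ‖x‖ ^ 2 := fun x hx => by
    have hxp := norm_pos_iff.2 hx
    rw [hP]
    simp only
    rw [Real.mul_rpow (by positivity) (abs_nonneg _), ← Real.rpow_mul hxp.le, hqs,
      Real.rpow_sub hxp, Real.rpow_two]
    field_simp
  have hd : 0 < μ ^ 2 - ν ^ 2 := by nlinarith
  obtain ⟨ρ, hρ, hρP⟩ := hsmall (((μ ^ 2 - ν ^ 2) / 2) ^ q⁻¹) (by positivity)
  have hPlt : ∀ x ≠ 0, ‖x‖ ^ σ ≤ min ρ 1 → P x < μ ^ 2 - ν ^ 2 := fun x hx hxρ => by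
    have h1 := Real.rpow_le_rpow (by positivity) (hρP x hx (hxρ.trans (min_le_left _ _))) hq.le
    rw [← Real.rpow_mul (by positivity), inv_mul_cancel₀ hq.ne', Real.rpow_one] at h1
    have : P x ≤ (μ ^ 2 - ν ^ 2) / 2 := h1
    linarith
  have hlapP : ∀ x ≠ 0, lap n u x = -(h ^ 2 - μ ^ 2 + P x) * u x / ‖x‖ ^ 2 := fun x hx => by
    rw [hlap x hx, mul_div_right_comm (|u x| ^ q), hPeq x hx]; ring
  have hc : 0 < min ρ 1 := by positivity
  obtain ⟨A₁, hA₁, h1⟩ := exists_le_of_small_potential hn hσ hc hν hu hlapP hPlt hsmall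
  obtain ⟨A₂, hA₂, h2⟩ := exists_le_of_small_potential (u := fun x => -u x) hn hσ hc hν
    (fun x hx => (hu x hx).neg)
    (fun x hx => by rw [lap_neg (hu x hx), hlapP x hx]; ring) hPlt
    (fun η hη => by simpa only [abs_neg] using hsmall η hη)
  refine ⟨min ρ 1, hc, min_le_right _ _, A₁ + A₂, by positivity, fun x hx hxc => ?_⟩
  have h3 := h1 x hx hxc
  have h4 := h2 x hx hxc
  have h5 : 0 < ‖x‖ ^ (-h + σ * ν) := by have := norm_pos_iff.2 hx; positivity
  have h6 := mul_pos hA₁ h5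
  have h7 := mul_pos hA₂ h5
  exact abs_le.2 ⟨by linarith, by linarith⟩

/-- Asymptotics at an end for the critical Hardy–Sobolev equation. -/
theorem exists_limit_of_hardySobolev {h μ q s σ : ℝ} (hn3 : 3 ≤ n) (hn : (n : ℝ) = 2 * h + 2)
    (hσ : σ = 1 ∨ σ = -1) (hμ : 0 < μ)
    (hs : 0 < s) (hq : 0 < q) (hqs : h * q = 2 - s)
    {u : EuclideanSpace ℝ (Fin n) → ℝ} (hu : ∀ x ≠ 0, ContDiffAt ℝ 2 u x)
    (hlap : ∀ x ≠ 0, lap n u x = -(h ^ 2 - μ ^ 2) * u x / ‖x‖ ^ 2 - |u x| ^ q * u x / ‖x‖ ^ s)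
    (hInt : Integrable fun x => |u x| ^ (n / h : ℝ)) :
    ∃ K A c δ : ℝ, 0 < c ∧ 0 < δ ∧ ∀ x ≠ 0, ‖x‖ ^ σ ≤ c →
      |‖x‖ ^ (h - σ * μ) * u x - K| ≤ A * (‖x‖ ^ σ) ^ δ := by
  have hh : 0 < h := by
    have : (3 : ℝ) ≤ n := by exact_mod_cast hn3
    linarith
  obtain ⟨ν, hν1, hνμ⟩ := exists_between (div_lt_self hμ (by linarith : 1 < 1 + q))
  have hν : 0 < ν := lt_trans (by positivity) hν1
  have hνq : μ < ν * (1 + q) := (div_lt_iff₀ (by linarith)).1 hν1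
  obtain ⟨c, hc, hc1, A, hA, hAu⟩ :=
    exists_abs_le_of_hardySobolev hn hh hσ hν hνμ hs hq hqs hu hlap hInt
  set τ := min (ν * (1 + q)) (√(μ ^ 2 + 1 / 3)) with hτdef
  have hτ : μ < τ := lt_min hνq (Real.lt_sqrt_of_sq_lt (by linarith))
  have hτ' : τ ^ 2 - μ ^ 2 ≤ 1 / 3 := by
    have h1 : τ ^ 2 ≤ √(μ ^ 2 + 1 / 3) ^ 2 :=
      pow_le_pow_left₀ (hμ.trans hτ).le (min_le_right _ _) 2
    rw [Real.sq_sqrt (by positivity)] at h1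
    linarith
  have hf : ∀ x ≠ 0, ‖x‖ ^ σ ≤ c →
      |(|u x| ^ q * u x / ‖x‖ ^ s)| ≤ A ^ (q + 1) * ‖x‖ ^ (-h + σ * τ) / ‖x‖ ^ 2 := by
    intro x hx hxc
    have hxp := norm_pos_iff.2 hx
    have hxσ : 0 < ‖x‖ ^ σ := by positivity
    rw [abs_div, abs_mul, abs_of_nonneg (by positivity : (0 : ℝ) ≤ |u x| ^ q),
      abs_of_nonneg (by positivity : (0 : ℝ) ≤ ‖x‖ ^ s)]
    have h1 : |u x| ^ q * |u x| ≤ (A * ‖x‖ ^ (-h + σ * ν)) ^ (q + 1) := by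
      rw [← Real.rpow_add_one' (abs_nonneg _) (by positivity)]
      exact Real.rpow_le_rpow (abs_nonneg _) (hAu x hx hxc) (by positivity)
    have h2 : (A * ‖x‖ ^ (-h + σ * ν)) ^ (q + 1) / ‖x‖ ^ s
        = A ^ (q + 1) * (‖x‖ ^ (-h + σ * (ν * (1 + q))) / ‖x‖ ^ 2) := by
      rw [Real.mul_rpow hA.le (by positivity), mul_div_assoc, ← Real.rpow_two,
        ← Real.rpow_mul hxp.le, ← Real.rpow_sub hxp, ← Real.rpow_sub hxp]
      congr 2
      linear_combination -hqs
    have h3 : ‖x‖ ^ (-h + σ * (ν * (1 + q))) ≤ ‖x‖ ^ (-h + σ * τ) := by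
      rw [norm_rpow_add_sign hx, norm_rpow_add_sign hx]
      exact mul_le_mul_of_nonneg_left (Real.rpow_le_rpow_of_exponent_ge hxσ (hxc.trans hc1)
        (min_le_left _ _)) (by positivity)
    calc |u x| ^ q * |u x| / ‖x‖ ^ s ≤ (A * ‖x‖ ^ (-h + σ * ν)) ^ (q + 1) / ‖x‖ ^ s := by gcongr
      _ = A ^ (q + 1) * (‖x‖ ^ (-h + σ * (ν * (1 + q))) / ‖x‖ ^ 2) := h2
      _ ≤ A ^ (q + 1) * (‖x‖ ^ (-h + σ * τ) / ‖x‖ ^ 2) := by gcongr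
      _ = _ := by ring
  have hend : ∀ η > 0, ∃ ε > 0, ∀ x ≠ 0, ‖x‖ ^ σ ≤ ε → |u x| ≤ η * ‖x‖ ^ (-h + σ * -μ) := by
    intro η hη
    obtain ⟨ε, hε, h1⟩ := norm_rpow_le_of_end (n := n) (h := h) (μ := (μ + ν) / 2) (σ := σ)
      (by positivity) (div_pos hη hA)
    refine ⟨min (min ε c) 1, by positivity, fun x hx hxε => ?_⟩
    have hxp := norm_pos_iff.2 hx
    have hxσ : 0 < ‖x‖ ^ σ := by positivity
    have h2 := hAu x hx (hxε.trans ((min_le_left _ _).trans (min_le_right _ _)))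
    have h3 := h1 x hx (hxε.trans ((min_le_left _ _).trans (min_le_left _ _)))
    have h4 : ‖x‖ ^ (-h + σ * ν) * A ≤ η * ‖x‖ ^ (-h + σ * -μ) := by
      rw [div_mul_eq_mul_div, le_div_iff₀ hA] at h3
      rw [norm_rpow_add_sign hx] at h3 ⊢
      rw [norm_rpow_add_sign hx] at h3 ⊢
      have h5 : (‖x‖ ^ σ) ^ ν = (‖x‖ ^ σ) ^ ((μ + ν) / 2) * (‖x‖ ^ σ) ^ ((ν - μ) / 2) := by
        rw [← Real.rpow_add hxσ]; congr 1; ring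
      have h6 : (‖x‖ ^ σ) ^ (-μ) = (‖x‖ ^ σ) ^ (-((μ + ν) / 2)) * (‖x‖ ^ σ) ^ ((ν - μ) / 2) := by
        rw [← Real.rpow_add hxσ]; congr 1; ring
      have h7 := mul_le_mul_of_nonneg_right h3 (by positivity : 0 ≤ (‖x‖ ^ σ) ^ ((ν - μ) / 2))
      rw [h5, h6]
      linarith
    linarith
  obtain ⟨K, B, hK⟩ := exists_limit_of_hardy_source hn3 hn hσ hμ hτ hτ' hc (by positivity)
    hu hlap hf hend
  exact ⟨K, B, c, τ - μ, hc, sub_pos.2 hτ, hK⟩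

end EndAsymptotics

section EntireSolutions

variable {n : ℕ}

theorem tendsto_of_forall_abs_sub_le {α : Type*} {l : Filter α} {f g : α → ℝ} {K A c δ : ℝ}
    (hc : 0 < c) (hδ : 0 < δ) (hg : Tendsto g l (nhds 0))
    (hfg : ∀ᶠ x in l, g x ≤ c → |f x - K| ≤ A * g x ^ δ) : Tendsto f l (nhds K) := by
  rw [tendsto_iff_dist_tendsto_zero]
  have h1 : Tendsto (fun x => A * g x ^ δ) l (nhds 0) := by
    simpa [Real.zero_rpow hδ.ne'] using (hg.rpow_const (Or.inr hδ.le)).const_mul A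
  refine squeeze_zero' (Eventually.of_forall fun _ => dist_nonneg) ?_ h1
  filter_upwards [hfg, hg.eventually_le_const hc] with x h2 h3
  exact h2 h3

theorem eventually_abs_le_of_tendsto {α : Type*} {l : Filter α} {f : α → ℝ} {K : ℝ}
    (hf : Tendsto f l (nhds K)) : ∀ᶠ x in l, |f x| ≤ |K| + 1 :=
  hf.abs.eventually_le_const (lt_add_one _)

/-- A continuous function on the punctured space with power-like behaviour at both ends satisfies
the corresponding two-sided bound. -/
theorem exists_abs_le_div_of_tendsto {a b K₁ K₂ : ℝ} (hab : a ≤ b)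
    {u : EuclideanSpace ℝ (Fin n) → ℝ} (hu : ∀ x ≠ 0, ContinuousAt u x)
    (h0 : Tendsto (fun x => ‖x‖ ^ a * u x) (nhdsWithin 0 {0}ᶜ) (nhds K₁))
    (hinf : Tendsto (fun x => ‖x‖ ^ b * u x) (cocompact _) (nhds K₂)) :
    ∃ C > 0, ∀ x ≠ 0, |u x| ≤ C / (‖x‖ ^ a + ‖x‖ ^ b) := by
  have h1 := eventually_nhdsWithin_iff.1 (eventually_abs_le_of_tendsto h0)
  obtain ⟨r, hr, hr1⟩ := Metric.eventually_nhds_iff.1 h1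
  have h2 := eventually_abs_le_of_tendsto hinf
  rw [← Metric.cobounded_eq_cocompact, ← comap_norm_atTop] at h2
  obtain ⟨t, ht, htu⟩ := mem_comap.1 h2
  obtain ⟨R, hR⟩ := mem_atTop_sets.1 ht
  set S : Set (EuclideanSpace ℝ (Fin n)) :=
    Metric.closedBall 0 (max R 1) \ Metric.ball 0 (min r 1) with hS
  have hSc : IsCompact S := (isCompact_closedBall _ _).diff Metric.isOpen_ball
  have hS0 : ∀ x ∈ S, x ≠ 0 := by
    rintro x ⟨-, hx⟩ rfl
    exact hx (Metric.mem_ball_self (by positivity))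
  obtain ⟨B, hB⟩ := hSc.exists_bound_of_continuousOn
    (f := fun x => (‖x‖ ^ a + ‖x‖ ^ b) * u x) fun x hx =>
      (((continuousAt_norm_rpow a (hS0 x hx)).add (continuousAt_norm_rpow b (hS0 x hx))).mul
        (hu x (hS0 x hx))).continuousWithinAt
  refine ⟨2 * (|K₁| + 1) + 2 * (|K₂| + 1) + |B|, by positivity, fun x hx => ?_⟩
  have hxp := norm_pos_iff.2 hx
  rw [le_div_iff₀ (by positivity)]
  have hK₁ := abs_nonneg K₁
  have hK₂ := abs_nonneg K₂
  have hB0 := abs_nonneg B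
  have habs : ∀ d : ℝ, |‖x‖ ^ d * u x| = |u x| * ‖x‖ ^ d := fun d => by
    rw [abs_mul, abs_of_pos (by positivity), mul_comm]
  rw [mul_add]
  by_cases hxS : x ∈ S
  · have h3 := hB x hxS
    rw [Real.norm_eq_abs, abs_mul, abs_of_pos (by positivity)] at h3
    linarith [le_abs_self B]
  · rcases lt_or_ge ‖x‖ (min r 1) with h3 | h3
    · have h4 := hr1 (y := x) (by rw [dist_zero_right]; exact h3.trans_le (min_le_left _ _)) hx
      have h5 : ‖x‖ ^ b ≤ ‖x‖ ^ a :=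
        Real.rpow_le_rpow_of_exponent_ge hxp (h3.le.trans (min_le_right _ _)) hab
      have h6 := mul_le_mul_of_nonneg_left h5 (abs_nonneg (u x))
      rw [habs] at h4
      linarith
    · have h4 : max R 1 < ‖x‖ := by
        by_contra! h4
        exact hxS ⟨mem_closedBall_zero_iff.2 h4, by
          rw [Metric.mem_ball, dist_zero_right, not_lt]; exact h3⟩
      have h5 : |‖x‖ ^ b * u x| ≤ |K₂| + 1 :=
        htu (hR ‖x‖ ((le_max_left _ _).trans h4.le))
      have h6 : ‖x‖ ^ a ≤ ‖x‖ ^ b :=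
        Real.rpow_le_rpow_of_exponent_le ((le_max_right _ _).trans h4.le) hab
      have h7 := mul_le_mul_of_nonneg_left h6 (abs_nonneg (u x))
      rw [habs] at h5
      linarith

end EntireSolutions

/-- Entire solutions: asymptotics and global pointwise bound:
a finite-energy `C²` solution of `−Δu − γ|x|^{-2}u = |u|^{2⋆(s)−2}u/|x|^s` on `ℝⁿ\{0}`
satisfies `|x|^{β₋}u(x) → K₁` as `x → 0`, `|x|^{β₊}u(x) → K₂` as `|x| → ∞`, and hence
`|u(x)| ≤ C/(|x|^{β₋}+|x|^{β₊})` everywhere. -/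
theorem stmt_11 (n : ℕ) (hn : 3 ≤ n) (γ : ℝ) (hγ : γ < ((n : ℝ) - 2) ^ 2 / 4)
    (s : ℝ) (hs0 : 0 < s) (hs2 : s < 2)
    (u : EuclideanSpace ℝ (Fin n) → ℝ)
    (hreg : ContDiffOn ℝ 2 u {(0 : EuclideanSpace ℝ (Fin n))}ᶜ)
    (hu1 : Integrable (fun x : EuclideanSpace ℝ (Fin n) => ‖fderiv ℝ u x‖ ^ 2))
    (hu2 : Integrable (fun x : EuclideanSpace ℝ (Fin n) =>
      |u x| ^ (2 * (n : ℝ) / ((n : ℝ) - 2))))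
    (heq : ∀ x : EuclideanSpace ℝ (Fin n), x ≠ 0 →
      -lap n u x - γ * u x / ‖x‖ ^ 2
        = |u x| ^ (2 * ((n : ℝ) - s) / ((n : ℝ) - 2) - 2) * u x / ‖x‖ ^ s) :
    (∃ K₁ : ℝ, Tendsto
        (fun x : EuclideanSpace ℝ (Fin n) =>
          ‖x‖ ^ (((n : ℝ) - 2) / 2 - Real.sqrt (((n : ℝ) - 2) ^ 2 / 4 - γ)) * u x)
        (nhdsWithin 0 {(0 : EuclideanSpace ℝ (Fin n))}ᶜ) (nhds K₁)) ∧
    (∃ K₂ : ℝ, Tendsto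
        (fun x : EuclideanSpace ℝ (Fin n) =>
          ‖x‖ ^ (((n : ℝ) - 2) / 2 + Real.sqrt (((n : ℝ) - 2) ^ 2 / 4 - γ)) * u x)
        (Filter.cocompact (EuclideanSpace ℝ (Fin n))) (nhds K₂)) ∧
    ∃ C > (0 : ℝ), ∀ x : EuclideanSpace ℝ (Fin n), x ≠ 0 →
      |u x| ≤ C / (‖x‖ ^ (((n : ℝ) - 2) / 2 - Real.sqrt (((n : ℝ) - 2) ^ 2 / 4 - γ)) +
        ‖x‖ ^ (((n : ℝ) - 2) / 2 + Real.sqrt (((n : ℝ) - 2) ^ 2 / 4 - γ))) := by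

  set h : ℝ := ((n : ℝ) - 2) / 2 with hh
  set μ : ℝ := √(((n : ℝ) - 2) ^ 2 / 4 - γ) with hμdef
  have hn' : (3 : ℝ) ≤ n := by exact_mod_cast hn
  have hn2 : (n : ℝ) = 2 * h + 2 := by rw [hh]; ring
  have hn2' : (n : ℝ) - 2 = 2 * h := by rw [hh]; ring
  have hμ : 0 < μ := Real.sqrt_pos.2 (by linarith)
  have hμ2 : h ^ 2 - μ ^ 2 = γ := by
    rw [hμdef, Real.sq_sqrt (by linarith), hh]; ring
  have hh0 : 0 < h := by linarith
  have hu : ∀ x ≠ 0, ContDiffAt ℝ 2 u x := fun x hx =>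
    hreg.contDiffAt (isOpen_compl_singleton.mem_nhds hx)
  have hexp : 2 * ((n : ℝ) - s) / (n - 2) - 2 = (2 - s) / h := by
    rw [hn2', hn2]; field_simp; ring
  have hInt : Integrable fun x => |u x| ^ (n / h : ℝ) := by
    have e : (n : ℝ) / h = 2 * n / (n - 2) := by rw [hn2']; field_simp
    rwa [e]
  have hlap : ∀ x ≠ 0, lap n u x
      = -(h ^ 2 - μ ^ 2) * u x / ‖x‖ ^ 2 - |u x| ^ ((2 - s) / h) * u x / ‖x‖ ^ s := fun x hx => by
    have := heq x hx
    rw [hexp] at this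
    rw [hμ2, ← this]; ring
  have key := fun {σ : ℝ} (hσ : σ = 1 ∨ σ = -1) => exists_limit_of_hardySobolev hn hn2 hσ hμ hs0
    (div_pos (sub_pos.2 hs2) hh0) (mul_div_cancel₀ _ hh0.ne') hu hlap hInt
  have hzero : ∃ K₁ : ℝ, Tendsto (fun x => ‖x‖ ^ (h - μ) * u x) (nhdsWithin 0 {0}ᶜ) (nhds K₁) := by
    obtain ⟨K, A, c, δ, hc, hδ, hK⟩ := key (Or.inl rfl)
    refine ⟨K, tendsto_of_forall_abs_sub_le (A := A) hc hδ (g := fun x => ‖x‖) ?_ ?_⟩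
    · exact tendsto_norm_zero.mono_left nhdsWithin_le_nhds
    · filter_upwards [self_mem_nhdsWithin] with x hx
      simpa only [Real.rpow_one, one_mul] using hK x hx
  have hinf : ∃ K₂ : ℝ, Tendsto (fun x => ‖x‖ ^ (h + μ) * u x) (cocompact _) (nhds K₂) := by
    obtain ⟨K, A, c, δ, hc, hδ, hK⟩ := key (Or.inr rfl)
    refine ⟨K, tendsto_of_forall_abs_sub_le (A := A) hc hδ (g := fun x => ‖x‖ ^ (-1 : ℝ)) ?_ ?_⟩
    · exact (tendsto_rpow_neg_atTop one_pos).comp (tendsto_norm_cocompact_atTop)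
    · filter_upwards [(isCompact_singleton (x := 0)).compl_mem_cocompact] with x hx
      simpa only [neg_one_mul, sub_neg_eq_add] using hK x hx
  refine ⟨hzero, hinf, ?_⟩
  obtain ⟨K₁, hK₁⟩ := hzero
  obtain ⟨K₂, hK₂⟩ := hinf
  exact exists_abs_le_div_of_tendsto (by linarith) (fun x hx => (hu x hx).continuousAt) hK₁ hK₂
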